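/- Subtraction theorem: suppose the meromorphic mapping Φ = (φ₁,…,φ_n) admits an algebraic addition theorem and let θ be a primitive element as described. Then there exist rational functions S₁,…,S_n of 2n+2 variables (quotients of polynomials in ℂ[x₀, x₁,…,x_n, y₀, y₁,…,y_n] with denominators not identically vanishing along the functions) such that φ_k(u−v) = S_k(θ(u), φ₁(u),…,φ_n(u); θ(v), φ₁(v),…,φ_n(v)) for k = 1,…,n, for all (u, v) in a nonempty open subset of ℂⁿ × ℂⁿ on which all functions involved are analytic and the denominators are nonzero. -/

import Mathlib

open MvPolynomial

/-- The partial derivative `∂f/∂u_p` of a function on ℂⁿ. -/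
noncomputable def pd {n : ℕ} (f : (Fin n → ℂ) → ℂ) (p : Fin n) (u : Fin n → ℂ) : ℂ :=
  fderiv ℂ f u (Pi.single p 1)

/-- `f` is meromorphic on ℂⁿ: a quotient of two everywhere-analytic functions. -/
def Mero {n : ℕ} (f : (Fin n → ℂ) → ℂ) : Prop :=
  ∃ g h : (Fin n → ℂ) → ℂ, (∀ u, AnalyticAt ℂ g u) ∧ (∀ u, AnalyticAt ℂ h u) ∧
    (∃ u, h u ≠ 0) ∧ ∀ u, h u ≠ 0 → f u = g u / h u

/-- The Jacobian determinant of the family `φ` is not identically zero. -/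
def AnalyticallyIndep {n : ℕ} (φ : Fin n → (Fin n → ℂ) → ℂ) : Prop :=
  ∃ u : Fin n → ℂ, (∀ j, AnalyticAt ℂ (φ j) u) ∧
    Matrix.det (Matrix.of fun k p => pd (φ k) p u) ≠ 0

/-- `Φ = (φ₁,…,φ_n)` admits an algebraic addition theorem: for each `k` there is a
polynomial `G_k` in the variables `λ` (= `none`), `x_j` (= `some (inl j)`) and
`y_j` (= `some (inr j)`), of degree ≥ 1 in `λ`, with
`G_k(φ_k(u+v); φ(u), φ(v)) = 0` wherever all functions involved are analytic. -/
def AdmitsAAT {n : ℕ} (φ : Fin n → (Fin n → ℂ) → ℂ) : Prop :=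
  ∀ k : Fin n, ∃ G : MvPolynomial (Option (Fin n ⊕ Fin n)) ℂ,
    1 ≤ G.degreeOf none ∧
    ∀ u v : Fin n → ℂ, (∀ j, AnalyticAt ℂ (φ j) u) → (∀ j, AnalyticAt ℂ (φ j) v) →
      AnalyticAt ℂ (φ k) (u + v) →
      eval (fun i => i.elim (φ k (u + v)) (Sum.elim (fun j => φ j u) fun j => φ j v)) G = 0

/-- The valuation sending the variable `none` to `θ(u)` and `some j` to `φ_j(u)`. -/
noncomputable def tval {n : ℕ} (θ : (Fin n → ℂ) → ℂ) (φ : Fin n → (Fin n → ℂ) → ℂ)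
    (u : Fin n → ℂ) : Option (Fin n) → ℂ :=
  fun i => i.elim (θ u) fun j => φ j u

/-- `f` is a rational function on ℂⁿ. -/
def RatFn {n : ℕ} (f : (Fin n → ℂ) → ℂ) : Prop :=
  ∃ P Q : MvPolynomial (Fin n) ℂ, Q ≠ 0 ∧
    ∃ s : Set (Fin n → ℂ), IsOpen s ∧ s.Nonempty ∧
      ∀ u ∈ s, f u = eval u P / eval u Q

section PartP1

open Filter Topology Metric

/-- Removable singularity, germ version. -/
lemma rs_germ {f : ℂ → ℂ} {t : ℂ} (hd : ∀ᶠ s in 𝓝[≠] t, DifferentiableAt ℂ f s)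
    {K : ℝ} (hb : ∀ᶠ s in 𝓝[≠] t, ‖f s‖ ≤ K) :
    ∃ g : ℂ → ℂ, AnalyticAt ℂ g t ∧ f =ᶠ[𝓝[≠] t] g ∧ ‖g t‖ ≤ K := by
  have hlim := Complex.tendsto_limUnder_of_differentiable_on_punctured_nhds_of_bounded_under hd
    (by
      refine ⟨K + ‖f t‖, ?_⟩
      rw [eventually_map]
      filter_upwards [hb] with s hs
      exact (norm_sub_le _ _).trans (by linarith))
  refine ⟨Function.update f t (limUnder (𝓝[≠] t) f), ?_, ?_, ?_⟩
  · apply Complex.analyticAt_of_differentiable_on_punctured_nhds_of_continuousAt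
    · filter_upwards [hd, self_mem_nhdsWithin] with s hs hne
      refine hs.congr_of_eventuallyEq ?_
      have : {t}ᶜ ∈ 𝓝 s := isOpen_compl_singleton.mem_nhds hne
      filter_upwards [this] with x hx
      exact Function.update_of_ne hx _ _
    · exact continuousAt_update_same.2 hlim
  · filter_upwards [self_mem_nhdsWithin] with s hne
    exact (Function.update_of_ne hne _ _).symm
  · rw [Function.update_self]
    exact le_of_tendsto hlim.norm hb

lemma limUnder_eq_of_germ {f g : ℂ → ℂ} {t : ℂ} (hg : AnalyticAt ℂ g t)
    (h : f =ᶠ[𝓝[≠] t] g) : limUnder (𝓝[≠] t) f = g t := by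
  apply Tendsto.limUnder_eq
  exact (hg.continuousAt.tendsto.mono_left nhdsWithin_le_nhds).congr' h.symm

lemma limUnder_germ {f g : ℂ → ℂ} {t : ℂ} (hg : AnalyticAt ℂ g t)
    (h : f =ᶠ[𝓝[≠] t] g) : (fun s => limUnder (𝓝[≠] s) f) =ᶠ[𝓝 t] g := by
  have h1 : ∀ᶠ s in 𝓝 t, AnalyticAt ℂ g s := hg.eventually_analyticAt
  rw [EventuallyEq, eventually_nhdsWithin_iff] at h
  filter_upwards [h1, h.eventually_nhds] with s hs hs2
  apply limUnder_eq_of_germ hs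
  by_cases hst : s = t
  · subst hst
    exact eventually_nhdsWithin_iff.2 hs2
  · have : {t}ᶜ ∈ 𝓝 s := isOpen_compl_singleton.mem_nhds hst
    apply Filter.Eventually.filter_mono nhdsWithin_le_nhds
    filter_upwards [hs2, this] with x hx hx2 using hx hx2

/-- A function with polynomial growth which is holomorphic up to (two layers of) discrete
exceptional sets extends to an entire function. -/
lemma entire_ext {f : ℂ → ℂ} {bad : Set ℂ} (hbad : bad.Finite) {b : ℂ → ℝ} (hbc : Continuous b)
    (hb : ∀ t, ‖f t‖ ≤ b t)
    (hd : ∀ t ∉ bad, ∀ᶠ s in 𝓝[≠] t, DifferentiableAt ℂ f s) :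
    ∃ g : ℂ → ℂ, Differentiable ℂ g ∧ (∀ t, ‖g t‖ ≤ b t) ∧ ∀ t ∉ bad, f =ᶠ[𝓝[≠] t] g := by
  classical
  have hbε : ∀ (F : ℂ → ℂ) (t : ℂ) (ε : ℝ), 0 < ε → (∀ t, ‖F t‖ ≤ b t) →
      ∀ᶠ s in 𝓝[≠] t, ‖F s‖ ≤ b t + ε := by
    intro F t ε hε hF
    have : ∀ᶠ s in 𝓝 t, b s < b t + ε :=
      hbc.continuousAt.eventually_lt continuousAt_const (by linarith)
    filter_upwards [nhdsWithin_le_nhds this] with s hs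
    exact (hF s).trans hs.le
  have key : ∀ (F : ℂ → ℂ) (t : ℂ), (∀ t, ‖F t‖ ≤ b t) →
      (∀ᶠ s in 𝓝[≠] t, DifferentiableAt ℂ F s) →
      ∃ g : ℂ → ℂ, AnalyticAt ℂ g t ∧ F =ᶠ[𝓝[≠] t] g ∧ ‖g t‖ ≤ b t := by
    intro F t hF hFd
    obtain ⟨g, hg, hfg, -⟩ := rs_germ hFd (hbε F t 1 one_pos hF)
    refine ⟨g, hg, hfg, ?_⟩
    refine le_of_forall_pos_le_add fun ε hε => ?_
    refine le_of_tendsto (hg.continuousAt.tendsto.mono_left (nhdsWithin_le_nhds (s := {t}ᶜ))).norm ?_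
    filter_upwards [hfg, hbε F t ε hε hF] with s hs hs2
    rw [← hs]; exact hs2
  have hb0 : ∀ t, 0 ≤ b t := fun t => (norm_nonneg _).trans (hb t)
  set f1 : ℂ → ℂ := fun t => if t ∈ bad then 0 else limUnder (𝓝[≠] t) f with hf1
  have hopen : IsOpen badᶜ := hbad.isClosed.isOpen_compl
  have h1 : ∀ t ∉ bad, ∃ g : ℂ → ℂ, AnalyticAt ℂ g t ∧ f =ᶠ[𝓝[≠] t] g ∧ f1 =ᶠ[𝓝 t] g
      ∧ ‖g t‖ ≤ b t := by
    intro t ht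
    obtain ⟨g, hg, hfg, hgb⟩ := key f t hb (hd t ht)
    refine ⟨g, hg, hfg, ?_, hgb⟩
    filter_upwards [limUnder_germ hg hfg, hopen.mem_nhds ht] with s hs hs2
    rw [← hs, hf1]
    exact if_neg hs2
  have hf1b : ∀ t, ‖f1 t‖ ≤ b t := by
    intro t
    by_cases ht : t ∈ bad
    · simp [hf1, ht, hb0]
    · obtain ⟨g, -, -, h, h'⟩ := h1 t ht
      rw [h.self_of_nhds]; exact h'
  have hf1d : ∀ t ∉ bad, DifferentiableAt ℂ f1 t := by
    intro t ht
    obtain ⟨g, hg, -, h, h'⟩ := h1 t ht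
    exact hg.differentiableAt.congr_of_eventuallyEq h
  have hpunct : ∀ t, ∀ᶠ s in 𝓝[≠] t, DifferentiableAt ℂ f1 s := by
    intro t
    have : (bad \ {t})ᶜ ∈ 𝓝 t := (hbad.subset Set.sdiff_subset).isClosed.isOpen_compl.mem_nhds
      (by simp)
    filter_upwards [nhdsWithin_le_nhds this, self_mem_nhdsWithin] with s hs hs2
    exact hf1d s (fun h => hs ⟨h, hs2⟩)
  choose g hg hfg hgb using fun t => key f1 t hf1b (hpunct t)
  refine ⟨fun t => limUnder (𝓝[≠] t) f1, ?_, ?_, ?_⟩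
  · intro t
    exact (hg t).differentiableAt.congr_of_eventuallyEq (limUnder_germ (hg t) (hfg t))
  · intro t
    dsimp only
    rw [limUnder_eq_of_germ (hg t) (hfg t)]; exact hgb t
  · intro t ht
    obtain ⟨g', hg', h2, h3, -⟩ := h1 t ht
    have h4 := limUnder_germ hg' (h3.filter_mono nhdsWithin_le_nhds)
    filter_upwards [h2, nhdsWithin_le_nhds h4] with s hs hs2
    rw [hs, ← hs2]

lemma iteratedDeriv_eq_zero_of_growth {g : ℂ → ℂ} (hg : Differentiable ℂ g) {C : ℝ} {m : ℕ}
    (hb : ∀ t, ‖g t‖ ≤ C * (1 + ‖t‖) ^ m) {k : ℕ} (hk : m < k) : iteratedDeriv k g 0 = 0 := by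
  rw [← norm_le_zero_iff]
  have hC : 0 ≤ C := by simpa using (norm_nonneg _).trans (hb 0)
  have h1 : ∀ᶠ R : ℝ in atTop, ‖iteratedDeriv k g 0‖ ≤ k.factorial * (C * 2 ^ m) * R⁻¹ := by
    filter_upwards [eventually_ge_atTop 1] with R hR
    have hR0 : 0 < R := by linarith
    have := Complex.norm_iteratedDeriv_le_of_forall_mem_sphere_norm_le (c := 0) (R := R)
      (C := C * (2 * R) ^ m) (f := g) k hR0 hg.diffContOnCl (by
        intro z hz
        have hz' : ‖z‖ = R := by simpa using hz
        refine (hb z).trans ?_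
        gcongr
        rw [hz']; linarith)
    refine this.trans ?_
    obtain ⟨j, rfl⟩ := Nat.exists_eq_add_of_lt hk
    have e : R⁻¹ * R ^ (m + j + 1) = R ^ (m+j) := by
      rw [pow_succ]; field_simp
    rw [div_le_iff₀ (by positivity), mul_assoc _ R⁻¹, e, mul_pow]
    have : R ^ m ≤ R ^ (m + j) := pow_le_pow_right₀ hR (by omega)
    calc _ = (m + j + 1).factorial * (C * 2 ^ m) * R ^ m := by ring
      _ ≤ _ := by gcongr
  have h2 : Tendsto (fun R : ℝ => k.factorial * (C * 2 ^ m) * R⁻¹) atTop (𝓝 0) := by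
    simpa using tendsto_inv_atTop_zero.const_mul (k.factorial * (C * 2 ^ m) : ℝ)
  exact ge_of_tendsto h2 h1

lemma multilinear_poly {ι : Type*} [Fintype ι] [DecidableEq ι] {k : ℕ}
    (q : ContinuousMultilinearMap ℂ (fun _ : Fin k => ι → ℂ) ℂ) (z0 : ι → ℂ) :
    ∃ p : MvPolynomial ι ℂ, ∀ z, MvPolynomial.eval z p = q fun _ => z - z0 := by
  refine ⟨∑ r : Fin k → ι, (∏ i, (MvPolynomial.X (r i) - MvPolynomial.C (z0 (r i)))) *
    MvPolynomial.C (q fun i => Pi.single (r i) 1), fun z => ?_⟩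
  have e : (fun _ : Fin k => z - z0) =
    fun _ : Fin k => ∑ j : ι, (z j - z0 j) • (Pi.single j (1:ℂ) : ι → ℂ) := by
    funext i
    ext j
    simp [Finset.sum_apply, Pi.single_apply]
  rw [e, ContinuousMultilinearMap.map_sum]
  simp only [ContinuousMultilinearMap.map_smul_univ]
  simp

/-- A germ which is polynomial of bounded degree on all lines is a polynomial. -/
lemma poly_of_lines {ι : Type*} [Fintype ι] {f : (ι → ℂ) → ℂ} {z0 : ι → ℂ}
    (hf : AnalyticAt ℂ f z0) (m : ℕ)
    (h : ∀ c : ι → ℂ, ∃ g : ℂ → ℂ, Differentiable ℂ g ∧ (∃ C : ℝ, ∀ t, ‖g t‖ ≤ C * (1 + ‖t‖) ^ m) ∧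
      (fun t : ℂ => f (z0 + t • c)) =ᶠ[𝓝[≠] 0] g) :
    ∃ p : MvPolynomial ι ℂ, ∀ᶠ z in 𝓝 z0, f z = MvPolynomial.eval z p := by
  classical
  obtain ⟨q, r, hq⟩ := hf
  have hz : ∀ k, m < k → ∀ c, q k (fun _ => c) = 0 := by
    intro k hk c
    obtain ⟨g, hg, ⟨C, hC⟩, hfg⟩ := h c
    have hga : AnalyticAt ℂ g 0 := hg.analyticAt 0
    set u : ℂ →L[ℂ] (ι → ℂ) := (ContinuousLinearMap.id ℂ ℂ).smulRight c with hu
    have hq0 : HasFPowerSeriesAt (fun y => f (z0 + y)) q (u 0) := by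
      refine ⟨r, ?_⟩
      have := hq.comp_sub (-z0)
      simpa [add_comm] using this
    have hs := hq0.compContinuousLinearMap (u := u)
    have hcont : AnalyticAt ℂ (fun t : ℂ => f (z0 + t • c)) 0 := by
      have := hs.analyticAt
      simpa [Function.comp_def, hu] using this
    have heq : (fun t : ℂ => f (z0 + t • c)) =ᶠ[𝓝 0] g := by
      have h0 : (fun t : ℂ => f (z0 + t • c)) 0 = g 0 := by
        exact tendsto_nhds_unique_of_eventuallyEq
          (hcont.continuousAt.tendsto.mono_left (nhdsWithin_le_nhds (s := {0}ᶜ)))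
          (hga.continuousAt.tendsto.mono_left nhdsWithin_le_nhds) hfg
      rw [EventuallyEq, eventually_nhdsWithin_iff] at hfg
      filter_upwards [hfg] with s hs
      by_cases hs0 : s = 0
      · rw [hs0]; exact h0
      · exact hs hs0
    obtain ⟨pg, hpg⟩ := hga
    have hs' : HasFPowerSeriesAt g (q.compContinuousLinearMap u) 0 := by
      refine hs.congr ?_
      filter_upwards [heq] with t ht
      simpa [hu] using ht
    obtain ⟨rr, hrr⟩ := hs'
    have h3 := hrr.factorial_smul 1 k
    rw [← iteratedDeriv_eq_iteratedFDeriv, iteratedDeriv_eq_zero_of_growth hg hC hk] at h3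
    have h4 : (q.compContinuousLinearMap u) k (fun _ => (1:ℂ)) = 0 := by
      have := smul_eq_zero.1 h3
      exact this.resolve_left k.factorial_ne_zero
    rw [FormalMultilinearSeries.compContinuousLinearMap_apply] at h4
    simpa [Function.comp_def, hu] using h4
  choose P hP using fun k => multilinear_poly (q k) z0
  refine ⟨∑ k ∈ Finset.range (m+1), P k, ?_⟩
  have hball : Metric.eball z0 r ∈ 𝓝 z0 := Metric.eball_mem_nhds _ hq.r_pos
  filter_upwards [hball] with z hzb
  have hsum := hq.hasSum_sub hzb
  rw [map_sum]
  simp only [hP]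
  refine hsum.unique (hasSum_sum_of_ne_finset_zero ?_)
  intro k hk
  exact hz k (by simpa using hk) _

end PartP1

section PartP2

open Filter Topology Metric

/-- `f` is a quotient of an entire function by a power of `H`, where `H ≠ 0`. -/
def MF {ι : Type*} [Fintype ι] (H f : (ι → ℂ) → ℂ) : Prop :=
  ∃ (m : ℕ) (G : (ι → ℂ) → ℂ), (∀ w, AnalyticAt ℂ G w) ∧ ∀ w, H w ≠ 0 → f w * H w ^ m = G w

section MFsec
variable {ι : Type*} [Fintype ι] {H f g : (ι → ℂ) → ℂ}

lemma eventually_ne_of_analytic (hH : ∀ w, AnalyticAt ℂ H w) {w : ι → ℂ} (hw : H w ≠ 0) :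
    ∀ᶠ x in 𝓝 w, H x ≠ 0 := (hH w).continuousAt.eventually_ne hw

lemma MF.analyticAt (hH : ∀ w, AnalyticAt ℂ H w) (hf : MF H f) {w : ι → ℂ} (hw : H w ≠ 0) :
    AnalyticAt ℂ f w := by
  obtain ⟨m, G, hG, h⟩ := hf
  have h1 : AnalyticAt ℂ (fun x => G x / H x ^ m) w :=
    (hG w).div ((hH w).pow m) (pow_ne_zero _ hw)
  refine h1.congr ?_
  filter_upwards [eventually_ne_of_analytic hH hw] with x hx
  rw [← h x hx]
  field_simp

lemma MF.const (c : ℂ) : MF H (fun _ => c) := ⟨0, fun _ => c, fun _ => analyticAt_const, by simp⟩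

lemma MF.add (hH : ∀ w, AnalyticAt ℂ H w) (hf : MF H f) (hg : MF H g) :
    MF H (fun w => f w + g w) := by
  obtain ⟨m, F, hF, h⟩ := hf
  obtain ⟨m', G, hG, h'⟩ := hg
  refine ⟨m + m', fun w => F w * H w ^ m' + G w * H w ^ m,
    fun w => ((hF w).mul ((hH w).pow _)).add ((hG w).mul ((hH w).pow _)), fun w hw => ?_⟩
  dsimp only
  rw [← h w hw, ← h' w hw]; ring

lemma MF.mul (hf : MF H f) (hg : MF H g) : MF H (fun w => f w * g w) := by
  obtain ⟨m, F, hF, h⟩ := hf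
  obtain ⟨m', G, hG, h'⟩ := hg
  refine ⟨m + m', fun w => F w * G w, fun w => (hF w).mul (hG w), fun w hw => ?_⟩
  dsimp only
  rw [← h w hw, ← h' w hw]; ring

lemma MF.neg (hf : MF H f) : MF H (fun w => - f w) := by
  obtain ⟨m, F, hF, h⟩ := hf
  refine ⟨m, fun w => - F w, fun w => (hF w).neg, fun w hw => ?_⟩
  dsimp only
  rw [← h w hw]; ring

lemma MF.sub (hH : ∀ w, AnalyticAt ℂ H w) (hf : MF H f) (hg : MF H g) :
    MF H (fun w => f w - g w) := by
  simpa [sub_eq_add_neg] using hf.add hH hg.neg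

lemma MF.pow (hf : MF H f) (k : ℕ) : MF H (fun w => f w ^ k) := by
  induction k with
  | zero => simpa using MF.const (H := H) 1
  | succ k ih => simpa [pow_succ] using ih.mul hf

lemma MF.sum (hH : ∀ w, AnalyticAt ℂ H w) {κ : Type*} (s : Finset κ) {f : κ → (ι → ℂ) → ℂ}
    (hf : ∀ i ∈ s, MF H (f i)) : MF H (fun w => ∑ i ∈ s, f i w) := by
  classical
  induction s using Finset.induction_on with
  | empty => simpa using MF.const (H := H) 0
  | insert a s ha ih =>
    simp only [Finset.sum_insert ha]
    exact (hf a (Finset.mem_insert_self _ _)).add hH (ih fun i hi => hf i (Finset.mem_insert_of_mem hi))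

lemma MF.mvpoly (hH : ∀ w, AnalyticAt ℂ H w) {κ : Type*} {x : κ → (ι → ℂ) → ℂ}
    (hx : ∀ i, MF H (x i)) (p : MvPolynomial κ ℂ) :
    MF H (fun w => MvPolynomial.eval (fun i => x i w) p) := by
  induction p using MvPolynomial.induction_on with
  | C a => simpa using MF.const (H := H) a
  | add p q hp hq => simpa using hp.add hH hq
  | mul_X p i hp => simpa using hp.mul (hx i)

lemma MF.congr (hf : MF H f) (h : ∀ w, H w ≠ 0 → g w = f w) : MF H g := by
  obtain ⟨m, F, hF, h'⟩ := hf
  exact ⟨m, F, hF, fun w hw => by rw [h w hw, h' w hw]⟩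

lemma MF.mono {H' : (ι → ℂ) → ℂ} (hH' : ∀ w, AnalyticAt ℂ H' w) (hf : MF H f) :
    MF (fun w => H w * H' w) f := by
  obtain ⟨m, F, hF, h'⟩ := hf
  refine ⟨m, fun w => F w * H' w ^ m, fun w => (hF w).mul ((hH' w).pow _), fun w hw => ?_⟩
  dsimp only
  rw [← h' w (left_ne_zero_of_mul hw)]; ring

lemma MF.comp {κ : Type*} [Fintype κ] {L : (κ → ℂ) → (ι → ℂ)} (hL : ∀ w, AnalyticAt ℂ L w)
    (hf : MF H f) : MF (fun w => H (L w)) (fun w => f (L w)) := by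
  obtain ⟨m, F, hF, h'⟩ := hf
  exact ⟨m, fun w => F (L w), fun w => (hF _).comp (hL w), fun w hw => h' _ hw⟩

lemma MF.dir (hH : ∀ w, AnalyticAt ℂ H w) (hf : MF H f) (v : ι → ℂ) :
    MF H (fun w => fderiv ℂ f w v) := by
  have hfa := fun w hw => hf.analyticAt hH (w := w) hw
  obtain ⟨m, F, hF, h'⟩ := hf
  refine ⟨m + 1, fun w => fderiv ℂ F w v * H w - m * F w * fderiv ℂ H w v, fun w => ?_, ?_⟩
  · refine AnalyticAt.sub (AnalyticAt.mul ?_ (hH w)) (AnalyticAt.mul (analyticAt_const.mul (hF w)) ?_)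
    · exact (ContinuousLinearMap.apply ℂ ℂ v).analyticAt _ |>.comp (hF w).fderiv
    · exact (ContinuousLinearMap.apply ℂ ℂ v).analyticAt _ |>.comp (hH w).fderiv
  · intro w hw
    have e : (fun x => f x * H x ^ m) =ᶠ[𝓝 w] F := by
      filter_upwards [eventually_ne_of_analytic hH hw] with x hx using h' x hx
    have e2 := e.fderiv_eq (𝕜 := ℂ)
    have d1 := (hfa w hw).differentiableAt.hasFDerivAt
    have d2 := ((hH w).differentiableAt.hasFDerivAt).pow m
    rw [(show fderiv ℂ (fun x => f x * H x ^ m) w = _ from (d1.mul d2).fderiv)] at e2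
    have e3 := congrArg (fun L => L v) e2
    simp only [add_apply, smul_apply, smul_eq_mul] at e3
    dsimp only
    rw [← e3, ← h' w hw]
    rcases m with _ | m
    · simp
    · simp [pow_succ]
      ring

/-- identity theorem along a map from a preconnected set -/
lemma MF.identity_comp {E : Type*} [NormedAddCommGroup E] [NormedSpace ℂ E]
    (hH : ∀ w, AnalyticAt ℂ H w) (hf : MF H f) {D : Set E} (hD : IsPreconnected D)
    {U : E → (ι → ℂ)} (hU : AnalyticOnNhd ℂ U D) {a : E → ℂ} (ha : AnalyticOnNhd ℂ a D)
    {t1 : E} (ht1 : t1 ∈ D) (hH1 : ∀ᶠ t in 𝓝 t1, H (U t) ≠ 0) (h : ∀ᶠ t in 𝓝 t1, f (U t) = a t) :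
    ∀ t ∈ D, H (U t) ≠ 0 → f (U t) = a t := by
  obtain ⟨m, F, hF, h'⟩ := hf
  have h1 : AnalyticOnNhd ℂ (fun t => F (U t)) D := fun t ht => (hF _).comp (hU t ht)
  have h2 : AnalyticOnNhd ℂ (fun t => a t * H (U t) ^ m) D :=
    fun t ht => (ha t ht).mul (((hH _).comp (hU t ht)).pow m)
  have h3 := h1.eqOn_of_preconnected_of_eventuallyEq h2 hD ht1 (by
    filter_upwards [hH1, h] with t ht ht'
    rw [← h' _ ht, ht'])
  intro t ht hHt
  have h4 := h3 ht
  simp only at h4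
  rw [← h' _ hHt] at h4
  exact mul_right_cancel₀ (pow_ne_zero _ hHt) h4

lemma MF.identity (hH : ∀ w, AnalyticAt ℂ H w) (hf : MF H f) {w0 : ι → ℂ}
    (hw0 : H w0 ≠ 0) (h : ∀ᶠ w in 𝓝 w0, f w = 0) : ∀ w, H w ≠ 0 → f w = 0 := fun w hw =>
  hf.identity_comp hH isPreconnected_univ (U := id) (fun _ _ => analyticAt_id)
    (a := fun _ => 0) (fun _ _ => analyticAt_const) (Set.mem_univ w0)
    (eventually_ne_of_analytic hH hw0) h w (Set.mem_univ w) hw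

end MFsec

/-- evaluate a polynomial with polynomial coefficients -/
noncomputable def ev {ι : Type*} (Q : Polynomial (MvPolynomial ι ℂ)) (x : ℂ) (z : ι → ℂ) : ℂ :=
  (Q.map (MvPolynomial.eval z)).eval x

lemma ev_eq_sum {ι : Type*} (Q : Polynomial (MvPolynomial ι ℂ)) (x : ℂ) (z : ι → ℂ) :
    ev Q x z = ∑ i ∈ Finset.range (Q.natDegree + 1), MvPolynomial.eval z (Q.coeff i) * x ^ i := by
  rw [ev, Polynomial.eval_map, Polynomial.eval₂_eq_sum_range]

lemma analyticAt_mvpoly {ι : Type*} [Fintype ι] (p : MvPolynomial ι ℂ) (z : ι → ℂ) :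
    AnalyticAt ℂ (fun z => MvPolynomial.eval z p) z := by
  induction p using MvPolynomial.induction_on with
  | C a => simpa using analyticAt_const
  | add p q hp hq =>
    simp only [map_add]
    exact hp.add hq
  | mul_X p i hp =>
    simp only [map_mul, MvPolynomial.eval_X]
    exact hp.mul ((ContinuousLinearMap.proj (R := ℂ) i).analyticAt z)

lemma analyticAt_ev {ι : Type*} [Fintype ι] (Q : Polynomial (MvPolynomial ι ℂ)) (v : (ι → ℂ) × ℂ) :
    AnalyticAt ℂ (fun v : (ι → ℂ) × ℂ => ev Q v.2 v.1) v := by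
  simp only [ev_eq_sum]
  refine Finset.analyticAt_fun_sum _ fun i _ => ?_
  refine AnalyticAt.mul ?_ (analyticAt_snd.pow i)
  exact (analyticAt_mvpoly (Q.coeff i) v.1).comp analyticAt_fst

lemma analyticAt_ev_comp {ι : Type*} [Fintype ι] (Q : Polynomial (MvPolynomial ι ℂ)) {E : Type*}
    [NormedAddCommGroup E] [NormedSpace ℂ E] {a : E → ℂ} {z : E → ι → ℂ} {t : E}
    (ha : AnalyticAt ℂ a t) (hz : AnalyticAt ℂ z t) : AnalyticAt ℂ (fun t => ev Q (a t) (z t)) t :=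
  AnalyticAt.fun_comp (f := fun t => (z t, a t)) (analyticAt_ev Q (z t, a t)) (hz.prod ha)

lemma MF.ev {ι κ : Type*} [Fintype ι] {H : (ι → ℂ) → ℂ} (hH : ∀ w, AnalyticAt ℂ H w)
    {a : (ι → ℂ) → ℂ} {x : κ → (ι → ℂ) → ℂ} (ha : MF H a)
    (hx : ∀ i, MF H (x i)) (Q : Polynomial (MvPolynomial κ ℂ)) :
    MF H (fun w => ev Q (a w) (fun i => x i w)) := by
  simp only [ev_eq_sum]
  exact MF.sum hH _ fun i _ => (MF.mvpoly hH hx _).mul (ha.pow i)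

/-- bound for polynomials -/
lemma mvpoly_bound {ι : Type*} [Fintype ι] (p : MvPolynomial ι ℂ) :
    ∃ (C : ℝ) (m : ℕ), 0 ≤ C ∧ ∀ z : ι → ℂ, ‖MvPolynomial.eval z p‖ ≤ C * (1 + ‖z‖) ^ m := by
  induction p using MvPolynomial.induction_on with
  | C a => exact ⟨‖a‖, 0, norm_nonneg _, by simp⟩
  | add p q hp hq =>
    obtain ⟨C, m, hC, h⟩ := hp
    obtain ⟨C', m', hC', h'⟩ := hq
    refine ⟨C + C', m + m', by positivity, fun z => ?_⟩
    have hz : 1 ≤ 1 + ‖z‖ := by linarith [norm_nonneg z]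
    rw [map_add, add_mul]
    refine (norm_add_le _ _).trans (add_le_add ((h z).trans ?_) ((h' z).trans ?_))
    · gcongr
      omega
    · gcongr
      omega
  | mul_X p i hp =>
    obtain ⟨C, m, hC, h⟩ := hp
    refine ⟨C, m + 1, hC, fun z => ?_⟩
    rw [map_mul, norm_mul, pow_succ, ← mul_assoc, MvPolynomial.eval_X]
    have := norm_le_pi_norm z i
    gcongr
    · exact h z
    · linarith

lemma root_bound {ι : Type*} [Fintype ι] (Q : Polynomial (MvPolynomial ι ℂ)) :
    ∃ (C : ℝ) (m : ℕ), 0 ≤ C ∧ ∀ (z : ι → ℂ) (x : ℂ), ev Q x z = 0 →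
      ‖MvPolynomial.eval z Q.leadingCoeff * x‖ ≤ C * (1 + ‖z‖) ^ m := by
  choose C m hC h using fun i => mvpoly_bound (Q.coeff i)
  set d := Q.natDegree with hd
  refine ⟨∑ i ∈ Finset.range (d + 1), C i, ∑ i ∈ Finset.range (d + 1), m i,
    Finset.sum_nonneg fun i _ => hC i, fun z x hx => ?_⟩
  have hz : 1 ≤ 1 + ‖z‖ := by linarith [norm_nonneg z]
  have hle : ∀ i ∈ Finset.range (d + 1), ‖MvPolynomial.eval z (Q.coeff i)‖ ≤
      C i * (1 + ‖z‖) ^ (∑ i ∈ Finset.range (d + 1), m i) := by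
    intro i hi
    refine (h i z).trans ?_
    have := hC i
    gcongr
    exact Finset.single_le_sum (f := m) (fun _ _ => Nat.zero_le _) hi
  have hsum : ∑ i ∈ Finset.range (d + 1), ‖MvPolynomial.eval z (Q.coeff i)‖ ≤
      (∑ i ∈ Finset.range (d + 1), C i) * (1 + ‖z‖) ^ (∑ i ∈ Finset.range (d + 1), m i) := by
    rw [Finset.sum_mul]
    exact Finset.sum_le_sum hle
  refine le_trans ?_ hsum
  rw [Polynomial.leadingCoeff, ← hd]
  by_cases hx1 : ‖x‖ ≤ 1
  · rw [norm_mul]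
    calc _ ≤ ‖MvPolynomial.eval z (Q.coeff d)‖ := by
          exact mul_le_of_le_one_right (norm_nonneg _) hx1
      _ ≤ _ := Finset.single_le_sum (f := fun i => ‖MvPolynomial.eval z (Q.coeff i)‖)
          (fun _ _ => norm_nonneg _) (Finset.self_mem_range_succ d)
  · push Not at hx1
    have hx0 : x ≠ 0 := by rintro rfl; simp at hx1; linarith
    rw [ev_eq_sum, ← hd, Finset.sum_range_succ] at hx
    rcases Nat.eq_zero_or_pos d with h0 | hpos
    · rw [h0] at hx ⊢
      simp at hx
      simp [hx]
    obtain ⟨e, he⟩ := Nat.exists_eq_succ_of_ne_zero hpos.ne'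
    have h1 : MvPolynomial.eval z (Q.coeff d) * x * x ^ e =
        - ∑ i ∈ Finset.range d, MvPolynomial.eval z (Q.coeff i) * x ^ i := by
      rw [mul_assoc, ← pow_succ', ← Nat.succ_eq_add_one, ← he]
      linear_combination hx
    have h2 : ‖MvPolynomial.eval z (Q.coeff d) * x‖ * ‖x‖ ^ e ≤
        (∑ i ∈ Finset.range d, ‖MvPolynomial.eval z (Q.coeff i)‖) * ‖x‖ ^ e := by
      rw [← norm_pow, ← norm_mul, h1, norm_neg, Finset.sum_mul]
      refine (norm_sum_le _ _).trans (Finset.sum_le_sum fun i hi => ?_)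
      rw [norm_mul, norm_pow, norm_pow]
      have : i < d := Finset.mem_range.1 hi
      gcongr
      · exact hx1.le
      omega
    have h3 := le_of_mul_le_mul_right h2 (pow_pos (by linarith) e)
    refine h3.trans (Finset.sum_le_sum_of_subset_of_nonneg ?_ fun _ _ _ => norm_nonneg _)
    exact Finset.range_subset_range.2 (by omega)

end PartP2

section PartP3

open Filter Topology Metric

lemma inverse_lemma {ι : Type*} [Fintype ι] {f : (ι → ℂ) → (ι → ℂ)} {w : ι → ℂ}
    (hf : AnalyticAt ℂ f w) (hinj : Function.Injective (fderiv ℂ f w)) :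
    ∃ σ : (ι → ℂ) → (ι → ℂ), AnalyticAt ℂ σ (f w) ∧ σ (f w) = w ∧ (∀ᶠ z in 𝓝 (f w), f (σ z) = z) ∧
      ∀ᶠ x in 𝓝 w, σ (f x) = x := by
  let e : (ι → ℂ) ≃L[ℂ] (ι → ℂ) :=
    (LinearEquiv.ofInjectiveEndo (fderiv ℂ f w : (ι → ℂ) →ₗ[ℂ] (ι → ℂ)) hinj).toContinuousLinearEquiv
  have he : (e : (ι → ℂ) →L[ℂ] (ι → ℂ)) = fderiv ℂ f w := by
    ext x i
    rfl
  have h1 : HasFDerivAt f (e : (ι → ℂ) →L[ℂ] (ι → ℂ)) w := by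
    rw [he]; exact hf.differentiableAt.hasFDerivAt
  have h2 : ContDiffAt ℂ ⊤ f w := hf.contDiffAt
  have hs := h2.hasStrictFDerivAt' h1 (by simp)
  refine ⟨hs.localInverse f e w, ?_, hs.localInverse_apply_image, hs.eventually_right_inverse,
    hs.eventually_left_inverse⟩
  have := h2.to_localInverse h1 (by simp)
  exact ContDiffAt.analyticAt this

lemma hasDerivAt_ev {ι : Type*} (P : Polynomial (MvPolynomial ι ℂ)) (z : ι → ℂ) (x : ℂ) :
    HasDerivAt (fun x => ev P x z) (ev P.derivative x z) x := by
  unfold ev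
  rw [← Polynomial.derivative_map]
  exact Polynomial.hasDerivAt _ _

lemma ev_derivative_ne_zero {ι : Type*} {P : Polynomial (MvPolynomial ι ℂ)} {z : ι → ℂ} {x : ℂ}
    (hs : (P.map (MvPolynomial.eval z)).Separable) (h0 : ev P x z = 0) :
    ev P.derivative x z ≠ 0 := by
  unfold ev at *
  rw [← Polynomial.derivative_map]
  obtain ⟨a, b, hab⟩ := hs
  intro h
  have := congrArg (Polynomial.eval x) hab
  rw [Polynomial.eval_add, Polynomial.eval_mul, Polynomial.eval_mul, h, h0] at this
  simp at this

lemma root_lemma {ι : Type*} [Fintype ι] {P : Polynomial (MvPolynomial ι ℂ)} {z0 : ι → ℂ} {x0 : ℂ}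
    (hs : (P.map (MvPolynomial.eval z0)).Separable) (h0 : ev P x0 z0 = 0) :
    ∃ ψ : (ι → ℂ) → ℂ, AnalyticAt ℂ ψ z0 ∧ ψ z0 = x0 ∧
      ∀ᶠ v : (ι → ℂ) × ℂ in 𝓝 (z0, x0), ev P v.2 v.1 = 0 ↔ ψ v.1 = v.2 := by
  have ha := analyticAt_ev P (z0, x0)
  have cd : ContDiffAt ℂ ⊤ (fun v : (ι → ℂ) × ℂ => ev P v.2 v.1) (z0, x0) := ha.contDiffAt
  have hd := ha.differentiableAt.hasFDerivAt
  have hne := ev_derivative_ne_zero hs h0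
  have hinv : (fderiv ℂ (fun v : (ι → ℂ) × ℂ => ev P v.2 v.1) (z0, x0) ∘L
      .inr ℂ (ι → ℂ) ℂ).IsInvertible := by
    refine ⟨ContinuousLinearEquiv.unitsEquivAut ℂ (.mk0 _ hne), ?_⟩
    ext
    have h1 : HasFDerivAt (fun x : ℂ => ev P x z0)
      (fderiv ℂ (fun v : (ι → ℂ) × ℂ => ev P v.2 v.1) (z0, x0) ∘L .inr ℂ (ι → ℂ) ℂ) x0 :=
      HasFDerivAt.comp (g := fun v : (ι → ℂ) × ℂ => ev P v.2 v.1) x0 hd (hasFDerivAt_prodMk_right z0 x0)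
    have h2 := (hasDerivAt_ev P z0 x0).unique h1.hasDerivAt
    rw [← h2]
    simp
  refine ⟨cd.implicitFunction (by simp) hinv,
    ContDiffAt.analyticAt (cd.contDiffAt_implicitFunction (by simp) hinv),
    cd.implicitFunction_apply_self (by simp) hinv, ?_⟩
  have := cd.eventually_apply_eq_iff_implicitFunction (by simp) hinv
  simpa only [h0] using this

/-- local uniqueness of roots -/
lemma root_unique {ι : Type*} [Fintype ι] {P : Polynomial (MvPolynomial ι ℂ)} {z0 : ι → ℂ} {x0 : ℂ}
    (hs : (P.map (MvPolynomial.eval z0)).Separable) (h0 : ev P x0 z0 = 0)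
    {E : Type*} [TopologicalSpace E] {l : Filter E} {z : E → ι → ℂ} {a b : E → ℂ}
    (hz : Tendsto z l (𝓝 z0)) (ha : Tendsto a l (𝓝 x0)) (hb : Tendsto b l (𝓝 x0))
    (ha0 : ∀ᶠ t in l, ev P (a t) (z t) = 0) (hb0 : ∀ᶠ t in l, ev P (b t) (z t) = 0) :
    a =ᶠ[l] b := by
  obtain ⟨ψ, -, -, h⟩ := root_lemma hs h0
  filter_upwards [(hz.prodMk_nhds ha).eventually h, (hz.prodMk_nhds hb).eventually h, ha0, hb0]
    with t h1 h2 h3 h4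
  rw [← h1.1 h3, ← h2.1 h4]

structure AD (ι : Type*) [Fintype ι] [DecidableEq ι] where
  H : (ι → ℂ) → ℂ
  Ψ : (ι → ℂ) → (ι → ℂ)
  τ : (ι → ℂ) → ℂ
  P : Polynomial (MvPolynomial ι ℂ)
  Δ : MvPolynomial ι ℂ
  Cm : ι → ι → Polynomial (MvPolynomial ι ℂ)
  hH : ∀ w, AnalyticAt ℂ H w
  hΨ : ∀ i, MF H (fun w => Ψ w i)
  hτ : MF H τ
  hP : ∀ w, H w ≠ 0 → ev P (τ w) (Ψ w) = 0
  hsep : ∀ z, MvPolynomial.eval z Δ ≠ 0 → (P.map (MvPolynomial.eval z)).Separable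
  hlc : P.leadingCoeff ∣ Δ
  hC : ∀ w, H w ≠ 0 → ∀ q p, ∑ k, ev (Cm q k) (τ w) (Ψ w) *
    fderiv ℂ (fun w => Ψ w k) w (Pi.single p 1) = if q = p then MvPolynomial.eval (Ψ w) Δ else 0

namespace AD
variable {ι : Type*} [Fintype ι] [DecidableEq ι] (𝒟 : AD ι)

def good (w : ι → ℂ) : Prop := 𝒟.H w ≠ 0 ∧ MvPolynomial.eval (𝒟.Ψ w) 𝒟.Δ ≠ 0

variable {𝒟}

lemma anΨ {w : ι → ℂ} (hw : 𝒟.H w ≠ 0) : AnalyticAt ℂ 𝒟.Ψ w :=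
  AnalyticAt.pi fun i => (𝒟.hΨ i).analyticAt 𝒟.hH hw

lemma anτ {w : ι → ℂ} (hw : 𝒟.H w ≠ 0) : AnalyticAt ℂ 𝒟.τ w := 𝒟.hτ.analyticAt 𝒟.hH hw

lemma contΔ (z : ι → ℂ) : ContinuousAt (fun z => MvPolynomial.eval z 𝒟.Δ) z :=
  (analyticAt_mvpoly 𝒟.Δ z).continuousAt

lemma good.eventually {w : ι → ℂ} (hw : 𝒟.good w) : ∀ᶠ x in 𝓝 w, 𝒟.good x := by
  have h1 := eventually_ne_of_analytic 𝒟.hH hw.1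
  have h2 : ContinuousAt (fun x => MvPolynomial.eval (𝒟.Ψ x) 𝒟.Δ) w :=
    ContinuousAt.comp (g := fun z => MvPolynomial.eval z 𝒟.Δ) (contΔ _) (anΨ hw.1).continuousAt
  exact h1.and (h2.eventually_ne hw.2)

lemma hC' {w : ι → ℂ} (hw : 𝒟.H w ≠ 0) (q : ι) (v : ι → ℂ) :
    ∑ k, ev (𝒟.Cm q k) (𝒟.τ w) (𝒟.Ψ w) * fderiv ℂ 𝒟.Ψ w v k =
      MvPolynomial.eval (𝒟.Ψ w) 𝒟.Δ * v q := by
  have h1 : ∀ k, fderiv ℂ 𝒟.Ψ w v k =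
      ∑ p, v p * fderiv ℂ (fun w => 𝒟.Ψ w k) w (Pi.single p 1) := by
    intro k
    have e1 : fderiv ℂ (fun w => 𝒟.Ψ w k) w v = fderiv ℂ 𝒟.Ψ w v k := by
      have h := hasFDerivAt_pi'.1 (anΨ hw).differentiableAt.hasFDerivAt k
      rw [h.fderiv]; rfl
    rw [← e1]
    conv_lhs => rw [pi_eq_sum_univ' v, map_sum]
    refine Finset.sum_congr rfl fun p _ => ?_
    rw [map_smul, smul_eq_mul]
  simp only [h1, Finset.mul_sum]
  rw [Finset.sum_comm]
  have h2 : ∀ p, ∑ k, ev (𝒟.Cm q k) (𝒟.τ w) (𝒟.Ψ w) *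
      (v p * fderiv ℂ (fun w => 𝒟.Ψ w k) w (Pi.single p 1)) =
      v p * if q = p then MvPolynomial.eval (𝒟.Ψ w) 𝒟.Δ else 0 := by
    intro p
    rw [← 𝒟.hC w hw q p, Finset.mul_sum]
    refine Finset.sum_congr rfl fun k _ => by ring
  rw [Finset.sum_congr rfl fun p _ => h2 p]
  simp [mul_comm]

lemma LL {w : ι → ℂ} (hw : 𝒟.good w) :
    ∃ σ : (ι → ℂ) → (ι → ℂ), AnalyticAt ℂ σ (𝒟.Ψ w) ∧ σ (𝒟.Ψ w) = w ∧
      (∀ᶠ z in 𝓝 (𝒟.Ψ w), 𝒟.Ψ (σ z) = z) ∧ ∀ᶠ x in 𝓝 w, σ (𝒟.Ψ x) = x := by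
  apply inverse_lemma (anΨ hw.1)
  rw [injective_iff_map_eq_zero]
  intro v hv
  ext q
  have := hC' hw.1 q v
  rw [hv] at this
  simpa [hw.2] using this.symm

/-- derivative of a lift -/
lemma DL {E : Type*} [NormedAddCommGroup E] [NormedSpace ℂ E] {s : E → ι → ℂ} {z : E → ι → ℂ} {a : E}
    (hs : DifferentiableAt ℂ s a) (h : ∀ᶠ t in 𝓝 a, 𝒟.Ψ (s t) = z t) (hg : 𝒟.good (s a)) (v : E)
    (q : ι) : MvPolynomial.eval (z a) 𝒟.Δ * fderiv ℂ s a v q =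
      ∑ k, ev (𝒟.Cm q k) (𝒟.τ (s a)) (z a) * fderiv ℂ z a v k := by
  have h1 := (anΨ hg.1).differentiableAt.hasFDerivAt.comp a hs.hasFDerivAt
  have h2 : fderiv ℂ z a = (fderiv ℂ 𝒟.Ψ (s a)).comp (fderiv ℂ s a) := by
    rw [← h1.fderiv]
    exact Filter.EventuallyEq.fderiv_eq (h.mono fun t ht => ht.symm)
  rw [h2, ← h.self_of_nhds, ← hC' hg.1]
  rfl

end AD

end PartP3

section PartP4

open Filter Topology Metric

lemma eventuallyEq_of_fderiv_eq {E F : Type*} [NormedAddCommGroup E] [NormedSpace ℂ E]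
    [NormedAddCommGroup F] [NormedSpace ℂ F] {f g : E → F} {x : E}
    (hf : ∀ᶠ y in 𝓝 x, DifferentiableAt ℂ f y) (hg : ∀ᶠ y in 𝓝 x, DifferentiableAt ℂ g y)
    (h : ∀ᶠ y in 𝓝 x, fderiv ℂ f y = fderiv ℂ g y) (hx : f x = g x) : f =ᶠ[𝓝 x] g := by
  obtain ⟨r, hr, hb⟩ := Metric.eventually_nhds_iff_ball.1 (hf.and (hg.and h))
  let _ : NormedSpace ℝ E := NormedSpace.restrictScalars ℝ ℂ E
  have := isOpen_ball.eqOn_of_fderiv_eq (𝕜 := ℂ) (s := ball x r) (convex_ball x r).isPreconnected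
    (fun y hy => (hb y hy).1.differentiableWithinAt)
    (fun y hy => (hb y hy).2.1.differentiableWithinAt) (fun y hy => (hb y hy).2.2)
    (mem_ball_self hr) hx
  exact eventually_of_mem (ball_mem_nhds x hr) this

namespace AD
variable {ι : Type*} [Fintype ι] [DecidableEq ι] {𝒟 : AD ι}

lemma per {w w' : ι → ℂ} (hw : 𝒟.good w) (hw' : 𝒟.good w') (hΨ : 𝒟.Ψ w = 𝒟.Ψ w')
    (hτ : 𝒟.τ w = 𝒟.τ w') (a : ι → ℂ) (ha : 𝒟.H a ≠ 0) (ha' : 𝒟.H (a + (w' - w)) ≠ 0) :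
    𝒟.Ψ (a + (w' - w)) = 𝒟.Ψ a := by
  obtain ⟨σ, hσ, hσw, hσr, -⟩ := LL hw'
  have hsw : σ (𝒟.Ψ w) = w' := by rw [hΨ, hσw]
  rw [← hΨ] at hσ hσr
  have hs : AnalyticAt ℂ (fun a => σ (𝒟.Ψ a)) w := hσ.comp (anΨ hw.1)
  have hlift : ∀ᶠ a in 𝓝 w, 𝒟.Ψ (σ (𝒟.Ψ a)) = 𝒟.Ψ a :=
    (anΨ hw.1).continuousAt.eventually hσr
  have hst : Tendsto (fun a => σ (𝒟.Ψ a)) (𝓝 w) (𝓝 w') := by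
    have := hs.continuousAt.tendsto
    rwa [hsw] at this
  have hgood : ∀ᶠ a in 𝓝 w, 𝒟.good (σ (𝒟.Ψ a)) := hst.eventually hw'.eventually
  have hτe : (fun a => 𝒟.τ (σ (𝒟.Ψ a))) =ᶠ[𝓝 w] 𝒟.τ := by
    refine root_unique (z := 𝒟.Ψ) (𝒟.hsep _ hw.2) (𝒟.hP w hw.1) (anΨ hw.1).continuousAt ?_
      (anτ hw.1).continuousAt ?_ ?_
    · rw [hτ]
      exact (anτ hw'.1).continuousAt.tendsto.comp hst
    · filter_upwards [hlift, hgood] with x hx hx'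
      rw [← hx]
      have := 𝒟.hP _ hx'.1
      rwa [hx] at this ⊢
    · filter_upwards [hw.eventually] with x hx using 𝒟.hP _ hx.1
  have hd : (fun a => σ (𝒟.Ψ a)) =ᶠ[𝓝 w] fun a => a + (w' - w) := by
    refine eventuallyEq_of_fderiv_eq (hs.eventually_analyticAt.mono fun _ h => h.differentiableAt)
      (Eventually.of_forall fun _ => by fun_prop) ?_ (by simp [hsw])
    filter_upwards [hs.eventually_analyticAt, hlift.eventually_nhds, hgood, hτe, hw.eventually]
      with x h1 h2 h3 h4 h5
    ext v q
    have := DL h1.differentiableAt h2 h3 v q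
    rw [h4, hC' h5.1] at this
    rw [mul_left_cancel₀ h5.2 this, fderiv_add_const]
    simp
  ext i
  have hmf : MF (fun a => 𝒟.H a * 𝒟.H (a + (w' - w)))
      (fun a => 𝒟.Ψ (a + (w' - w)) i - 𝒟.Ψ a i) := by
    have hL : ∀ a : ι → ℂ, AnalyticAt ℂ (fun a => a + (w' - w)) a :=
      fun a => analyticAt_id.add analyticAt_const
    have hH' : ∀ a : ι → ℂ, AnalyticAt ℂ (fun a => 𝒟.H (a + (w' - w))) a :=
      fun a => (𝒟.hH _).comp (hL a)
    refine MF.sub (fun a => (𝒟.hH a).mul (hH' a)) ?_ ((𝒟.hΨ i).mono hH')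
    have := ((𝒟.hΨ i).comp hL).mono 𝒟.hH
    simpa only [mul_comm] using this
  have := hmf.identity (fun a => (𝒟.hH a).mul ((𝒟.hH _).comp (analyticAt_id.add analyticAt_const)))
    (w0 := w) (by simpa using ⟨hw.1, hw'.1⟩) (by
      filter_upwards [hd, hlift] with x h1 h2
      rw [← h1, h2, sub_self]) a (mul_ne_zero ha ha')
  exact sub_eq_zero.1 this

lemma ext_line {ℓ : ℂ → ι → ℂ} {a : ℂ → ℂ} {tc : ℂ} {r : ℝ}
    (hℓ : AnalyticOnNhd ℂ ℓ (ball tc r)) (ha : AnalyticOnNhd ℂ a (ball tc r))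
    (hΔ : ∀ t ∈ ball tc r, MvPolynomial.eval (ℓ t) 𝒟.Δ ≠ 0)
    (hroot : ∀ t ∈ ball tc r, ev 𝒟.P (a t) (ℓ t) = 0) {t1 : ℂ} (ht1 : t1 ∈ ball tc r)
    {w1 : ι → ℂ} (hw1 : 𝒟.good w1) (hΨ1 : 𝒟.Ψ w1 = ℓ t1) (hτ1 : 𝒟.τ w1 = a t1) :
    ∃ U : ℂ → ι → ℂ, AnalyticOnNhd ℂ U (ball tc r) ∧
      (∀ t ∈ ball tc r, 𝒟.H (U t) ≠ 0 → 𝒟.Ψ (U t) = ℓ t ∧ 𝒟.τ (U t) = a t) ∧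
      ∀ t ∈ ball tc r, ∀ᶠ s in 𝓝[≠] t, 𝒟.H (U s) ≠ 0 := by
  set D := ball tc r with hD
  have hDo : IsOpen D := isOpen_ball
  have hDc : IsPreconnected D := (convex_ball tc r).isPreconnected
  let g : ℂ → ι → ℂ := fun t q =>
    (∑ k, ev (𝒟.Cm q k) (a t) (ℓ t) * deriv ℓ t k) / MvPolynomial.eval (ℓ t) 𝒟.Δ
  have hg : AnalyticOnNhd ℂ g D := by
    intro t ht
    refine AnalyticAt.pi fun q => AnalyticAt.div ?_ ((analyticAt_mvpoly _ _).comp (hℓ t ht)) (hΔ t ht)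
    refine Finset.analyticAt_fun_sum _ fun k _ => (analyticAt_ev_comp _ (ha t ht) (hℓ t ht)).mul ?_
    exact analyticAt_pi_iff.1 (hℓ t ht).deriv k
  obtain ⟨U, hU1, hU⟩ := hg.differentiableOn.isExactOn_ball.with_val_at t1 w1
  have hUa : AnalyticOnNhd ℂ U D :=
    DifferentiableOn.analyticOnNhd (fun t ht => (hU t ht).differentiableAt.differentiableWithinAt) hDo
  obtain ⟨σ, hσ, hσw, hσr, -⟩ := LL hw1
  rw [hΨ1] at hσ hσw hσr
  have hs : AnalyticAt ℂ (fun t => σ (ℓ t)) t1 := hσ.comp (hℓ t1 ht1)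
  have hlift : ∀ᶠ t in 𝓝 t1, 𝒟.Ψ (σ (ℓ t)) = ℓ t := (hℓ t1 ht1).continuousAt.eventually hσr
  have hst : Tendsto (fun t => σ (ℓ t)) (𝓝 t1) (𝓝 w1) := by
    have := hs.continuousAt.tendsto
    rwa [hσw] at this
  have hgood : ∀ᶠ t in 𝓝 t1, 𝒟.good (σ (ℓ t)) := hst.eventually hw1.eventually
  have hDt : ∀ᶠ t in 𝓝 t1, t ∈ D := hDo.mem_nhds ht1
  have hτe : (fun t => 𝒟.τ (σ (ℓ t))) =ᶠ[𝓝 t1] a := by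
    refine root_unique (z := ℓ) (𝒟.hsep _ (hΔ t1 ht1)) (hroot t1 ht1) (hℓ t1 ht1).continuousAt ?_
      (ha t1 ht1).continuousAt ?_ ?_
    · rw [← hτ1]
      exact (anτ hw1.1).continuousAt.tendsto.comp hst
    · filter_upwards [hlift, hgood] with x hx hx'
      have := 𝒟.hP _ hx'.1
      rwa [hx] at this
    · filter_upwards [hDt] with x hx using hroot x hx
  have hd : (fun t => σ (ℓ t)) =ᶠ[𝓝 t1] U := by
    refine eventuallyEq_of_fderiv_eq (hs.eventually_analyticAt.mono fun _ h => h.differentiableAt)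
      (hDt.mono fun t ht => (hU t ht).differentiableAt) ?_ (by simp [hσw, hU1])
    filter_upwards [hs.eventually_analyticAt, hlift.eventually_nhds, hgood, hτe, hDt]
      with x h1 h2 h3 h4 h5
    apply ContinuousLinearMap.ext_ring
    ext q
    have := DL h1.differentiableAt h2 h3 1 q
    rw [h4] at this
    rw [show fderiv ℂ U x 1 = deriv U x from rfl, (hU x h5).deriv]
    simp only [g]
    rw [eq_div_iff (hΔ x h5), mul_comm]
    exact this
  have hHe : ∀ᶠ t in 𝓝 t1, 𝒟.H (U t) ≠ 0 := by
    filter_upwards [hd, hgood] with t h1 h2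
    rw [← h1]; exact h2.1
  refine ⟨U, hUa, fun t ht hHt => ⟨?_, ?_⟩, fun t ht => ?_⟩
  · ext i
    refine (𝒟.hΨ i).identity_comp 𝒟.hH hDc hUa (a := fun t => ℓ t i)
      (fun t ht => analyticAt_pi_iff.1 (hℓ t ht) i) ht1 hHe ?_ t ht hHt
    filter_upwards [hd, hlift] with t h1 h2
    rw [← h1, h2]
  · refine 𝒟.hτ.identity_comp 𝒟.hH hDc hUa ha ht1 hHe ?_ t ht hHt
    filter_upwards [hd, hτe] with t h1 h2
    rw [← h1, h2]
  · by_contra hcon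
    have hfr : ∃ᶠ s in 𝓝[≠] t, 𝒟.H (U s) = 0 := hcon
    have hHU : AnalyticOnNhd ℂ (fun t => 𝒟.H (U t)) D := fun t ht => (𝒟.hH _).comp (hUa t ht)
    have := hHU.eqOn_zero_of_preconnected_of_frequently_eq_zero hDc ht hfr
    exact hHe.self_of_nhds (this ht1)

/-- roots over a point -/
noncomputable def roots (𝒟 : AD ι) (z : ι → ℂ) : Finset ℂ := (𝒟.P.map (MvPolynomial.eval z)).roots.toFinset

lemma lc_ne {z : ι → ℂ} (hz : MvPolynomial.eval z 𝒟.Δ ≠ 0) :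
    MvPolynomial.eval z 𝒟.P.leadingCoeff ≠ 0 := by
  obtain ⟨c, hc⟩ := 𝒟.hlc
  intro h
  apply hz
  rw [hc, map_mul, h, zero_mul]

lemma natDegree_eq {z : ι → ℂ} (hz : MvPolynomial.eval z 𝒟.Δ ≠ 0) :
    (𝒟.P.map (MvPolynomial.eval z)).natDegree = 𝒟.P.natDegree :=
  Polynomial.natDegree_map_of_leadingCoeff_ne_zero _ (lc_ne hz)

lemma card_roots_le (z : ι → ℂ) : (𝒟.roots z).card ≤ 𝒟.P.natDegree :=
  (Multiset.toFinset_card_le _).trans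
    ((Polynomial.card_roots' _).trans Polynomial.natDegree_map_le)

lemma mem_roots {z : ι → ℂ} (hz : MvPolynomial.eval z 𝒟.Δ ≠ 0) {x : ℂ} :
    x ∈ 𝒟.roots z ↔ ev 𝒟.P x z = 0 := by
  rw [roots, Multiset.mem_toFinset, Polynomial.mem_roots, Polynomial.IsRoot.def]; rfl
  intro h
  have := 𝒟.hsep z hz
  rw [h] at this
  exact Polynomial.not_separable_zero this

lemma card_roots {z : ι → ℂ} (hz : MvPolynomial.eval z 𝒟.Δ ≠ 0) :
    (𝒟.roots z).card = 𝒟.P.natDegree := by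
  rw [roots, Multiset.toFinset_card_of_nodup (Polynomial.nodup_roots (𝒟.hsep z hz)),
    ← natDegree_eq hz]
  exact (IsAlgClosed.splits _).natDegree_eq_card_roots.symm

lemma roots_local {zs : ι → ℂ} (hz : MvPolynomial.eval zs 𝒟.Δ ≠ 0) :
    ∃ ψ : ℂ → (ι → ℂ) → ℂ, (∀ r ∈ 𝒟.roots zs, AnalyticAt ℂ (ψ r) zs) ∧
      ∀ᶠ z in 𝓝 zs, 𝒟.roots z = (𝒟.roots zs).image (fun r => ψ r z) ∧
        Set.InjOn (fun r => ψ r z) (𝒟.roots zs) := by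
  have h1 : ∀ r : ℂ, ∃ ψ : (ι → ℂ) → ℂ, r ∈ 𝒟.roots zs → AnalyticAt ℂ ψ zs ∧ ψ zs = r ∧
      ∀ᶠ z in 𝓝 zs, ev 𝒟.P (ψ z) z = 0 := by
    intro r
    by_cases hr : r ∈ 𝒟.roots zs
    · obtain ⟨ψ, h1, h2, h3⟩ := root_lemma (𝒟.hsep zs hz) ((mem_roots hz).1 hr)
      refine ⟨ψ, fun _ => ⟨h1, h2, ?_⟩⟩
      have ht : Tendsto (fun z => (z, ψ z)) (𝓝 zs) (𝓝 (zs, r)) := by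
        rw [← h2]
        exact (continuousAt_id.prodMk h1.continuousAt)
      filter_upwards [ht.eventually h3] with z hz using hz.2 rfl
    · exact ⟨0, fun h => absurd h hr⟩
  choose ψ hψ using h1
  refine ⟨ψ, fun r hr => (hψ r hr).1, ?_⟩
  have hroot : ∀ᶠ z in 𝓝 zs, ∀ r ∈ 𝒟.roots zs, ev 𝒟.P (ψ r z) z = 0 :=
    (Filter.eventually_all_finset _).2 fun r hr => (hψ r hr).2.2
  have hinj : ∀ᶠ z in 𝓝 zs, ∀ r ∈ 𝒟.roots zs, ∀ r' ∈ 𝒟.roots zs, r ≠ r' → ψ r z ≠ ψ r' z := by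
    refine (Filter.eventually_all_finset _).2 fun r hr =>
      (Filter.eventually_all_finset _).2 fun r' hr' => ?_
    by_cases h : r = r'
    · simp [h]
    · have : ∀ᶠ z in 𝓝 zs, ψ r z ≠ ψ r' z := by
        have hc := ((hψ r hr).1.sub (hψ r' hr').1).continuousAt
        refine (hc.eventually_ne (y := 0) ?_).mono fun z hz => sub_ne_zero.1 hz
        rw [Pi.sub_apply, (hψ r hr).2.1, (hψ r' hr').2.1]
        exact sub_ne_zero.2 h
      exact this.mono fun _ h _ => h
  filter_upwards [hroot, hinj, (contΔ zs).eventually_ne hz] with z h1 h2 h3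
  have hI : Set.InjOn (fun r => ψ r z) (𝒟.roots zs) := by
    intro r hr r' hr' h
    by_contra hne
    exact h2 r hr r' hr' hne h
  refine ⟨(Finset.eq_of_subset_of_card_le ?_ ?_).symm, hI⟩
  · intro x hx
    obtain ⟨r, hr, rfl⟩ := Finset.mem_image.1 hx
    exact (mem_roots h3).2 (h1 r hr)
  · rw [Finset.card_image_of_injOn hI, card_roots hz]
    exact card_roots_le z

end AD

end PartP4

section PartP5

open Filter Topology Metric

namespace AD
variable {ι : Type*} [Fintype ι] [DecidableEq ι] {𝒟 : AD ι}

def att (𝒟 : AD ι) (z : ι → ℂ) (e : ℂ) : Prop := ∃ w, 𝒟.good w ∧ 𝒟.Ψ w = z ∧ 𝒟.τ w = e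

open Classical in
noncomputable def Eset (𝒟 : AD ι) (z : ι → ℂ) : Finset ℂ := (𝒟.roots z).filter (𝒟.att z)

open Classical in
noncomputable def lift (𝒟 : AD ι) (z : ι → ℂ) (e : ℂ) : ι → ℂ :=
  if h : 𝒟.att z e then h.choose else 0

noncomputable def S (𝒟 : AD ι) (ρ : (ι → ℂ) → ℂ) (z : ι → ℂ) : ℂ :=
  ∑ e ∈ 𝒟.Eset z, ρ (𝒟.lift z e)

def inv (𝒟 : AD ι) (ρ : (ι → ℂ) → ℂ) : Prop :=
  ∀ w w', 𝒟.good w → 𝒟.good w' → 𝒟.Ψ w = 𝒟.Ψ w' → 𝒟.τ w = 𝒟.τ w' → ρ w = ρ w'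

lemma lift_spec {z : ι → ℂ} {e : ℂ} (h : 𝒟.att z e) :
    𝒟.good (𝒟.lift z e) ∧ 𝒟.Ψ (𝒟.lift z e) = z ∧ 𝒟.τ (𝒟.lift z e) = e := by
  rw [lift, dif_pos h]; exact h.choose_spec

lemma inv.lift {ρ : (ι → ℂ) → ℂ} (hρ : 𝒟.inv ρ) {w : ι → ℂ} (hw : 𝒟.good w) :
    ρ (𝒟.lift (𝒟.Ψ w) (𝒟.τ w)) = ρ w := by
  have h := lift_spec (𝒟 := 𝒟) (z := 𝒟.Ψ w) (e := 𝒟.τ w) ⟨w, hw, rfl, rfl⟩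
  exact hρ _ _ h.1 hw h.2.1 h.2.2

lemma mem_Eset {z : ι → ℂ} {e : ℂ} : e ∈ 𝒟.Eset z ↔ 𝒟.att z e := by
  classical
  rw [Eset, Finset.mem_filter, and_iff_right_iff_imp]
  rintro ⟨w, hw, rfl, rfl⟩
  exact (mem_roots hw.2).2 (𝒟.hP w hw.1)

lemma card_Eset_le (z : ι → ℂ) : (𝒟.Eset z).card ≤ 𝒟.P.natDegree := by
  classical
  exact (Finset.card_filter_le _ _).trans (card_roots_le z)

lemma S_eq {z : ι → ℂ} {κ : Type*} {R : Finset κ} {U : κ → ι → ℂ}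
    (hU : ∀ r ∈ R, 𝒟.good (U r) ∧ 𝒟.Ψ (U r) = z)
    (hI : Set.InjOn (fun r => 𝒟.τ (U r)) R) (hE : 𝒟.Eset z ⊆ R.image (fun r => 𝒟.τ (U r)))
    {ρ : (ι → ℂ) → ℂ} (hρ : 𝒟.inv ρ) : 𝒟.S ρ z = ∑ r ∈ R, ρ (U r) := by
  have h1 : 𝒟.Eset z = R.image (fun r => 𝒟.τ (U r)) := by
    refine Finset.Subset.antisymm hE fun e he => ?_
    obtain ⟨r, hr, rfl⟩ := Finset.mem_image.1 he
    exact mem_Eset.2 ⟨U r, (hU r hr).1, (hU r hr).2, rfl⟩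
  rw [S, h1, Finset.sum_image hI]
  refine Finset.sum_congr rfl fun r hr => ?_
  have := hρ.lift (hU r hr).1
  rwa [(hU r hr).2] at this

lemma S_line {ρ : (ι → ℂ) → ℂ} (hρm : MF 𝒟.H ρ) (hρ : 𝒟.inv ρ) {ℓ : ℂ → ι → ℂ}
    (hℓ : ∀ t, AnalyticAt ℂ ℓ t) {ts : ℂ} (hΔ : MvPolynomial.eval (ℓ ts) 𝒟.Δ ≠ 0) :
    ∀ᶠ t in 𝓝[≠] ts, DifferentiableAt ℂ (fun t => 𝒟.S ρ (ℓ t)) t := by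
  classical
  obtain ⟨ψ, hψ, hloc⟩ := roots_local hΔ
  set R := 𝒟.roots (ℓ ts) with hR
  have hc := (hℓ ts).continuousAt
  have e1 : ∀ᶠ t in 𝓝 ts, ∀ r ∈ R, AnalyticAt ℂ (ψ r) (ℓ t) :=
    hc.eventually ((Filter.eventually_all_finset _).2 fun r hr => (hψ r hr).eventually_analyticAt)
  have e2 : ∀ᶠ t in 𝓝 ts, MvPolynomial.eval (ℓ t) 𝒟.Δ ≠ 0 :=
    hc.eventually ((contΔ (ℓ ts)).eventually_ne hΔ)
  obtain ⟨r0, hr0, hb⟩ := Metric.eventually_nhds_iff_ball.1 (e1.and (e2.and (hc.eventually hloc)))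
  set R1 := R.filter (fun r => ∃ t ∈ ball ts r0, 𝒟.att (ℓ t) (ψ r (ℓ t))) with hR1
  have hex : ∀ r : ℂ, ∃ U : ℂ → ι → ℂ, r ∈ R1 → AnalyticOnNhd ℂ U (ball ts r0) ∧
      (∀ t ∈ ball ts r0, 𝒟.H (U t) ≠ 0 → 𝒟.Ψ (U t) = ℓ t ∧ 𝒟.τ (U t) = ψ r (ℓ t)) ∧
      ∀ t ∈ ball ts r0, ∀ᶠ s in 𝓝[≠] t, 𝒟.H (U s) ≠ 0 := by
    intro r
    by_cases hr : r ∈ R1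
    · obtain ⟨hrR, t1, ht1, w1, hw1, hΨ1, hτ1⟩ := Finset.mem_filter.1 hr
      obtain ⟨U, hU⟩ := ext_line (𝒟 := 𝒟) (ℓ := ℓ) (a := fun t => ψ r (ℓ t)) (tc := ts) (r := r0)
        (fun t _ => hℓ t) (fun t ht => ((hb t ht).1 r hrR).comp (hℓ t)) (fun t ht => (hb t ht).2.1)
        (fun t ht => by
          have := (hb t ht).2.2.1
          refine (mem_roots (hb t ht).2.1).1 ?_
          rw [this]
          exact Finset.mem_image_of_mem _ hrR) ht1 hw1 hΨ1 hτ1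
      exact ⟨U, fun _ => hU⟩
    · exact ⟨0, fun h => absurd h hr⟩
  choose U hU using hex
  have hmem : ∀ᶠ t in 𝓝[≠] ts, t ∈ ball ts r0 :=
    eventually_nhdsWithin_of_eventually_nhds (ball_mem_nhds ts hr0)
  have hHe : ∀ᶠ t in 𝓝[≠] ts, ∀ r ∈ R1, 𝒟.H (U r t) ≠ 0 :=
    (Filter.eventually_all_finset _).2 fun r hr => (hU r hr).2.2 ts (mem_ball_self hr0)
  have hS : ∀ᶠ t in 𝓝[≠] ts, 𝒟.S ρ (ℓ t) = ∑ r ∈ R1, ρ (U r t) := by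
    filter_upwards [hmem, hHe] with t ht hHt
    have hk := fun r hr => (hU r hr).2.1 t ht (hHt r hr)
    have hbt := hb t ht
    refine S_eq (U := fun r => U r t) (fun r hr => ⟨⟨hHt r hr, ?_⟩, (hk r hr).1⟩) ?_ ?_ hρ
    · rw [(hk r hr).1]; exact hbt.2.1
    · intro r hr r' hr' h
      simp only at h
      rw [(hk r hr).2, (hk r' hr').2] at h
      exact hbt.2.2.2 (Finset.mem_filter.1 hr).1 (Finset.mem_filter.1 hr').1 h
    · intro e he
      have he' : e ∈ 𝒟.roots (ℓ t) := (Finset.mem_filter.1 he).1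
      rw [hbt.2.2.1] at he'
      obtain ⟨r, hr, rfl⟩ := Finset.mem_image.1 he'
      have hr1 : r ∈ R1 := Finset.mem_filter.2 ⟨hr, t, ht, mem_Eset.1 he⟩
      exact Finset.mem_image.2 ⟨r, hr1, (hk r hr1).2⟩
  have hS' := eventually_nhdsNE_eventually_nhds_iff.2 hS
  filter_upwards [hS', hmem, hHe] with t h5 h2 h3
  refine DifferentiableAt.congr_of_eventuallyEq ?_ h5
  exact (Finset.analyticAt_fun_sum _ fun r hr =>
    (hρm.analyticAt 𝒟.hH (h3 r hr)).fun_comp ((hU r hr).1 t h2)).differentiableAt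

end AD

end PartP5

section PartP6

open Filter Topology Metric

namespace AD
variable {ι : Type*} [Fintype ι] [DecidableEq ι] {𝒟 : AD ι}

lemma max_point (hex : ∃ w, 𝒟.good w) :
    ∃ (z0 : ι → ℂ) (J : Finset ℂ) (σ : ℂ → (ι → ℂ) → (ι → ℂ)), J.Nonempty ∧
      MvPolynomial.eval z0 𝒟.Δ ≠ 0 ∧
      (∀ e ∈ J, AnalyticAt ℂ (σ e) z0 ∧ 𝒟.good (σ e z0) ∧ 𝒟.Ψ (σ e z0) = z0 ∧
        ∀ᶠ w in 𝓝 (σ e z0), σ e (𝒟.Ψ w) = w) ∧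
      ∀ᶠ z in 𝓝 z0, (∀ e ∈ J, 𝒟.good (σ e z) ∧ 𝒟.Ψ (σ e z) = z) ∧
        Set.InjOn (fun e => 𝒟.τ (σ e z)) J ∧
        ∀ ρ, 𝒟.inv ρ → 𝒟.S ρ z = ∑ e ∈ J, ρ (σ e z) := by
  classical
  let N : Set ℕ := {c | ∃ w, 𝒟.good w ∧ (𝒟.Eset (𝒟.Ψ w)).card = c}
  have hNne : N.Nonempty := by
    obtain ⟨w, hw⟩ := hex
    exact ⟨_, w, hw, rfl⟩
  have hNb : BddAbove N := ⟨𝒟.P.natDegree, by rintro _ ⟨w, -, rfl⟩; exact card_Eset_le _⟩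
  obtain ⟨w0, hw0, hmax⟩ := Nat.sSup_mem hNne hNb
  have hmax' : ∀ w, 𝒟.good w → (𝒟.Eset (𝒟.Ψ w)).card ≤ (𝒟.Eset (𝒟.Ψ w0)).card := by
    intro w hw
    rw [hmax]
    exact le_csSup hNb ⟨w, hw, rfl⟩
  set z0 := 𝒟.Ψ w0 with hz0
  set J := 𝒟.Eset z0 with hJ
  have h1 : ∀ e : ℂ, ∃ σ : (ι → ℂ) → (ι → ℂ), e ∈ J → (AnalyticAt ℂ σ z0 ∧ 𝒟.good (σ z0) ∧
      𝒟.Ψ (σ z0) = z0 ∧ ∀ᶠ w in 𝓝 (σ z0), σ (𝒟.Ψ w) = w) ∧ 𝒟.τ (σ z0) = e ∧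
      ∀ᶠ z in 𝓝 z0, 𝒟.Ψ (σ z) = z := by
    intro e
    by_cases he : e ∈ J
    · obtain ⟨w, hw, hwz, hwe⟩ := mem_Eset.1 he
      obtain ⟨σ, h1, h2, h3, h4⟩ := LL hw
      rw [hwz] at h1 h2 h3
      refine ⟨σ, fun _ => ⟨⟨h1, ?_, ?_, ?_⟩, ?_, h3⟩⟩ <;> rw [h2] <;> assumption
    · exact ⟨id, fun h => absurd h he⟩
  choose σ hσ using h1
  refine ⟨z0, J, σ, ⟨𝒟.τ w0, mem_Eset.2 ⟨w0, hw0, rfl, rfl⟩⟩, hw0.2, fun e he => (hσ e he).1, ?_⟩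
  have e1 : ∀ᶠ z in 𝓝 z0, ∀ e ∈ J, 𝒟.good (σ e z) ∧ 𝒟.Ψ (σ e z) = z := by
    refine (Filter.eventually_all_finset _).2 fun e he => ?_
    obtain ⟨⟨h1, h2, h3, h4⟩, h5, h6⟩ := hσ e he
    exact (h1.continuousAt.eventually h2.eventually).and h6
  have hc : ∀ e ∈ J, ContinuousAt (fun z => 𝒟.τ (σ e z)) z0 := fun e he =>
    ContinuousAt.comp (f := σ e) (anτ (hσ e he).1.2.1.1).continuousAt (hσ e he).1.1.continuousAt
  have e2 : ∀ᶠ z in 𝓝 z0, ∀ e ∈ J, ∀ e' ∈ J, e ≠ e' → 𝒟.τ (σ e z) ≠ 𝒟.τ (σ e' z) := by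
    refine (Filter.eventually_all_finset _).2 fun r hr =>
      (Filter.eventually_all_finset _).2 fun r' hr' => ?_
    by_cases h : r = r'
    · simp [h]
    · have hd := (hc r hr).sub (hc r' hr')
      refine (hd.eventually_ne (y := 0) ?_).mono fun z hz _ => sub_ne_zero.1 hz
      rw [Pi.sub_apply, (hσ r hr).2.1, (hσ r' hr').2.1]
      exact sub_ne_zero.2 h
  filter_upwards [e1, e2] with z h1 h2
  have hI : Set.InjOn (fun e => 𝒟.τ (σ e z)) J := by
    intro r hr r' hr' h
    by_contra hne
    exact h2 r hr r' hr' hne h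
  refine ⟨h1, hI, fun ρ hρ => S_eq h1 hI ?_ hρ⟩
  refine (Finset.eq_of_subset_of_card_le ?_ ?_).ge
  · intro e he
    obtain ⟨r, hr, rfl⟩ := Finset.mem_image.1 he
    exact mem_Eset.2 ⟨σ r z, (h1 r hr).1, (h1 r hr).2, rfl⟩
  · rw [Finset.card_image_of_injOn hI]
    have he := mem_Eset.2 (⟨w0, hw0, rfl, rfl⟩ : 𝒟.att z0 (𝒟.τ w0))
    have := hmax' _ (h1 _ he).1
    rwa [(h1 _ he).2] at this

def PB (𝒟 : AD ι) (M : ℕ) (ρ : (ι → ℂ) → ℂ) : Prop :=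
  ∃ (K : ℝ) (m : ℕ), 0 ≤ K ∧ ∀ w, 𝒟.good w →
    ‖MvPolynomial.eval (𝒟.Ψ w) 𝒟.Δ ^ M * ρ w‖ ≤ K * (1 + ‖𝒟.Ψ w‖) ^ m

lemma PB.mul {M M' : ℕ} {ρ ρ' : (ι → ℂ) → ℂ} (h : 𝒟.PB M ρ) (h' : 𝒟.PB M' ρ') :
    𝒟.PB (M + M') (fun w => ρ w * ρ' w) := by
  obtain ⟨K, m, hK, h⟩ := h
  obtain ⟨K', m', hK', h'⟩ := h'
  refine ⟨K * K', m + m', by positivity, fun w hw => ?_⟩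
  have e : MvPolynomial.eval (𝒟.Ψ w) 𝒟.Δ ^ (M + M') * (ρ w * ρ' w) =
      (MvPolynomial.eval (𝒟.Ψ w) 𝒟.Δ ^ M * ρ w) * (MvPolynomial.eval (𝒟.Ψ w) 𝒟.Δ ^ M' * ρ' w) := by
    ring
  rw [e, norm_mul]
  calc _ ≤ (K * (1 + ‖𝒟.Ψ w‖) ^ m) * (K' * (1 + ‖𝒟.Ψ w‖) ^ m') := by
        gcongr
        · exact h w hw
        · exact h' w hw
    _ = _ := by ring

lemma PB.one : 𝒟.PB 1 (fun _ => 1) := by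
  obtain ⟨K, m, hK, h⟩ := mvpoly_bound 𝒟.Δ
  exact ⟨K, m, hK, fun w _ => by simpa using h _⟩

lemma PB.of_root {f : (ι → ℂ) → ℂ} {Q : Polynomial (MvPolynomial ι ℂ)} (hQ : Q.leadingCoeff ∣ 𝒟.Δ)
    (h : ∀ w, 𝒟.H w ≠ 0 → ev Q (f w) (𝒟.Ψ w) = 0) : 𝒟.PB 1 f := by
  obtain ⟨c, hc⟩ := hQ
  obtain ⟨K, m, hK, hb⟩ := root_bound Q
  obtain ⟨K', m', hK', hb'⟩ := mvpoly_bound c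
  refine ⟨K * K', m + m', by positivity, fun w hw => ?_⟩
  have := hb _ _ (h w hw.1)
  rw [hc, map_mul, pow_one, mul_right_comm, norm_mul]
  calc _ ≤ (K * (1 + ‖𝒟.Ψ w‖) ^ m) * (K' * (1 + ‖𝒟.Ψ w‖) ^ m') := by
        gcongr
        exact hb' _
    _ = _ := by ring

lemma PB.pow_mul {f g : (ι → ℂ) → ℂ} (hf : 𝒟.PB 1 f) (hg : 𝒟.PB 1 g) {a M : ℕ} (h : a ≤ M) :
    𝒟.PB (M + 1) (fun w => g w * f w ^ a) := by
  induction M generalizing a with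
  | zero =>
    obtain rfl : a = 0 := by omega
    simpa using hg
  | succ M ih =>
    rcases a with _ | a
    · simpa using (ih (Nat.zero_le _)).mul PB.one
    · have := (ih (a := a) (by omega)).mul hf
      simpa [pow_succ, mul_assoc] using this

lemma line_bound (z0 c : ι → ℂ) (t : ℂ) : 1 + ‖z0 + t • c‖ ≤ (1 + ‖z0‖ + ‖c‖) * (1 + ‖t‖) := by
  have h1 := norm_add_le z0 (t • c)
  rw [norm_smul] at h1
  nlinarith [norm_nonneg z0, norm_nonneg c, norm_nonneg t, mul_nonneg (norm_nonneg z0) (norm_nonneg t)]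

lemma bad_finite {z0 : ι → ℂ} (p : MvPolynomial ι ℂ) (h : MvPolynomial.eval z0 p ≠ 0) (c : ι → ℂ) :
    {t : ℂ | MvPolynomial.eval (z0 + t • c) p = 0}.Finite := by
  let q : Polynomial ℂ := MvPolynomial.aeval (fun i => Polynomial.C (z0 i) + Polynomial.X * Polynomial.C (c i)) p
  have hq : ∀ t, q.eval t = MvPolynomial.eval (z0 + t • c) p := by
    intro t
    have : (Polynomial.evalRingHom t).comp (MvPolynomial.aeval (R := ℂ)
        (fun i => Polynomial.C (z0 i) + Polynomial.X * Polynomial.C (c i))).toRingHom =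
        MvPolynomial.eval (z0 + t • c) := by
      ext <;> simp
      ring
    exact congrArg (fun f => f p) this
  have hq0 : q ≠ 0 := by
    intro h0
    apply h
    have := hq 0
    rw [h0] at this
    simpa using this.symm
  refine (Polynomial.finite_setOfPred_isRoot hq0).subset fun t ht => ?_
  simp only [Set.mem_ofPred_eq, Polynomial.IsRoot.def] at *
  rw [hq, ht]

lemma S_poly {z0 : ι → ℂ} (hz0 : MvPolynomial.eval z0 𝒟.Δ ≠ 0) {J : Finset ℂ}
    {σ : ℂ → (ι → ℂ) → (ι → ℂ)} (hσ : ∀ e ∈ J, AnalyticAt ℂ (σ e) z0 ∧ 𝒟.good (σ e z0))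
    {ρ : (ι → ℂ) → ℂ} (hρm : MF 𝒟.H ρ) (hρ : 𝒟.inv ρ) {M : ℕ} (hb : 𝒟.PB M ρ)
    (hS : ∀ᶠ z in 𝓝 z0, 𝒟.S ρ z = ∑ e ∈ J, ρ (σ e z)) :
    ∃ p : MvPolynomial ι ℂ, ∀ᶠ z in 𝓝 z0,
      MvPolynomial.eval z 𝒟.Δ ^ M * ∑ e ∈ J, ρ (σ e z) = MvPolynomial.eval z p := by
  obtain ⟨K, m, hK, hb⟩ := hb
  have hfa : AnalyticAt ℂ (fun z => MvPolynomial.eval z 𝒟.Δ ^ M * 𝒟.S ρ z) z0 := by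
    have h1 : AnalyticAt ℂ (fun z => MvPolynomial.eval z 𝒟.Δ ^ M * ∑ e ∈ J, ρ (σ e z)) z0 := by
      refine ((analyticAt_mvpoly _ _).pow M).mul (Finset.analyticAt_fun_sum _ fun e he => ?_)
      exact (hρm.analyticAt 𝒟.hH (hσ e he).2.1).fun_comp (hσ e he).1
    refine h1.congr ?_
    filter_upwards [hS] with z hz
    rw [hz]
  have hSb : ∀ z, ‖MvPolynomial.eval z 𝒟.Δ ^ M * 𝒟.S ρ z‖ ≤
      (𝒟.P.natDegree * K) * (1 + ‖z‖) ^ m := by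
    intro z
    rw [S, Finset.mul_sum]
    refine (norm_sum_le _ _).trans ?_
    have h1 : ∀ e ∈ 𝒟.Eset z, ‖MvPolynomial.eval z 𝒟.Δ ^ M * ρ (𝒟.lift z e)‖ ≤
        K * (1 + ‖z‖) ^ m := by
      intro e he
      obtain ⟨h1, h2, h3⟩ := lift_spec (mem_Eset.1 he)
      have := hb _ h1
      rwa [h2] at this
    refine (Finset.sum_le_card_nsmul _ _ _ h1).trans ?_
    rw [nsmul_eq_mul, mul_assoc]
    gcongr
    exact card_Eset_le z
  obtain ⟨p, hp⟩ := poly_of_lines hfa m fun c => by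
    have hℓ : ∀ t, AnalyticAt ℂ (fun t : ℂ => z0 + t • c) t := fun t =>
      analyticAt_const.add (analyticAt_id.smul analyticAt_const)
    set C := (𝒟.P.natDegree * K) * (1 + ‖z0‖ + ‖c‖) ^ m with hC
    obtain ⟨g, hg, hgb, hgf⟩ := entire_ext
      (f := fun t => MvPolynomial.eval (z0 + t • c) 𝒟.Δ ^ M * 𝒟.S ρ (z0 + t • c))
      (bad_finite 𝒟.Δ hz0 c) (b := fun t => C * (1 + ‖t‖) ^ m) (by fun_prop)
      (fun t => (hSb _).trans (by
        rw [hC, mul_assoc _ ((1 + ‖z0‖ + ‖c‖) ^ m), ← mul_pow]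
        gcongr
        exact line_bound z0 c t))
      (fun t ht => by
        filter_upwards [S_line hρm hρ hℓ ht] with s hs
        refine DifferentiableAt.mul ?_ hs
        exact (((analyticAt_mvpoly 𝒟.Δ _).fun_comp (hℓ s)).pow M).differentiableAt)
    refine ⟨g, hg, ⟨C, hgb⟩, hgf 0 ?_⟩
    simpa using hz0
  refine ⟨p, ?_⟩
  filter_upwards [hS, hp] with z h1 h2
  rw [← h1, h2]

end AD

lemma interp {r : ℕ} {V G : Matrix (Fin r) (Fin r) ℂ} {δ : ℂ} {F g : Fin r → ℂ}
    (hV : V.det ≠ 0) (hG : G = δ • (V.transpose * V)) (hg : g = δ • (V.transpose.mulVec F)) :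
    G.det • F = V.mulVec (G.adjugate.mulVec g) := by
  have hu : IsUnit V.det := isUnit_iff_ne_zero.2 hV
  have hx : V.mulVec (V⁻¹.mulVec F) = F := by
    rw [Matrix.mulVec_mulVec, Matrix.mul_nonsing_inv _ hu, Matrix.one_mulVec]
  set x := V⁻¹.mulVec F
  have hgx : g = G.mulVec x := by
    rw [hg, hG, ← hx, Matrix.smul_mulVec, Matrix.mulVec_mulVec]
  rw [hgx, Matrix.mulVec_mulVec (M := G.adjugate), Matrix.adjugate_mul, Matrix.smul_mulVec, Matrix.one_mulVec,
    Matrix.mulVec_smul, hx]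

lemma AD.AT {ι : Type*} [Fintype ι] [DecidableEq ι] (𝒟 : AD ι) {κ : Type*} (F : κ → (ι → ℂ) → ℂ)
    (hF : ∀ k, MF 𝒟.H (F k)) (Γ : κ → Polynomial (MvPolynomial ι ℂ))
    (hΓ : ∀ k w, 𝒟.H w ≠ 0 → ev (Γ k) (F k w) (𝒟.Ψ w) = 0)
    (hlcΓ : ∀ k, (Γ k).leadingCoeff ∣ 𝒟.Δ)
    (hper : ∀ ω : ι → ℂ, (∀ a, 𝒟.H a ≠ 0 → 𝒟.H (a + ω) ≠ 0 → 𝒟.Ψ (a + ω) = 𝒟.Ψ a) →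
      ∀ k a, 𝒟.H a ≠ 0 → 𝒟.H (a + ω) ≠ 0 → F k (a + ω) = F k a)
    (hex : ∃ w, 𝒟.good w) :
    ∃ w0, 𝒟.good w0 ∧ ∀ k, ∃ (Num : Polynomial (MvPolynomial ι ℂ)) (Den : MvPolynomial ι ℂ),
      ∀ᶠ w in 𝓝 w0, MvPolynomial.eval (𝒟.Ψ w) Den ≠ 0 ∧
        F k w * MvPolynomial.eval (𝒟.Ψ w) Den = ev Num (𝒟.τ w) (𝒟.Ψ w) := by
  classical
  obtain ⟨z0, J, σ, ⟨e0, he0⟩, hz0, hσ, hloc⟩ := AD.max_point hex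
  refine ⟨σ e0 z0, (hσ e0 he0).2.1, fun k => ?_⟩
  set r := J.card with hr
  let f : Fin r ≃ J := J.equivFin.symm
  have hsum : ∀ g : ℂ → ℂ, ∑ j : Fin r, g (f j) = ∑ e ∈ J, g e := by
    intro g
    rw [← Finset.sum_coe_sort J g]
    exact Equiv.sum_comp f (fun e : J => g e)
  have hinvF : 𝒟.inv (F k) := by
    intro w w' hw hw' h1 h2
    have := hper (w' - w) (fun a ha ha' => AD.per hw hw' h1 h2 a ha ha') k w hw.1
      (by simpa using hw'.1)
    simpa using this.symm
  have hinvτ : 𝒟.inv 𝒟.τ := fun w w' _ _ _ h => h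
  have hpow : ∀ g, 𝒟.inv g → ∀ a : ℕ, 𝒟.inv (fun w => g w * 𝒟.τ w ^ a) := by
    intro g hg a w w' h1 h2 h3 h4
    simp only
    rw [hg w w' h1 h2 h3 h4, h4]
  have hinv1 : 𝒟.inv (fun _ => 1) := fun _ _ _ _ _ _ => rfl
  have hPBτ : 𝒟.PB 1 𝒟.τ := AD.PB.of_root 𝒟.hlc 𝒟.hP
  have hPBF : 𝒟.PB 1 (F k) := AD.PB.of_root (hlcΓ k) (hΓ k)
  set M := 2 * r + 1 with hM
  have key : ∀ g, MF 𝒟.H g → 𝒟.inv g → 𝒟.PB 1 g → ∀ a : ℕ, ∃ p : MvPolynomial ι ℂ, a ≤ 2 * r →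
      ∀ᶠ z in 𝓝 z0, MvPolynomial.eval z 𝒟.Δ ^ M *
        ∑ j : Fin r, g (σ (f j) z) * 𝒟.τ (σ (f j) z) ^ a = MvPolynomial.eval z p := by
    intro g h1 h2 h3 a
    by_cases ha : a ≤ 2 * r
    · obtain ⟨p, hp⟩ := AD.S_poly hz0 (fun e he => ⟨(hσ e he).1, (hσ e he).2.1⟩)
        (h1.mul (𝒟.hτ.pow a)) (hpow g h2 a) (AD.PB.pow_mul hPBτ h3 ha)
        (hloc.mono fun z hz => hz.2.2 _ (hpow g h2 a))
      refine ⟨p, fun _ => hp.mono fun z hz => ?_⟩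
      rw [← hz, hsum fun e => g (σ e z) * 𝒟.τ (σ e z) ^ a]
    · exact ⟨0, fun h => absurd h ha⟩
  choose s hs using key _ (MF.const 1) hinv1 AD.PB.one
  choose q hq using key _ (hF k) hinvF hPBF
  let hp : Matrix (Fin r) (Fin r) (MvPolynomial ι ℂ) := Matrix.of fun a b => s (a + b)
  let qv : Fin r → MvPolynomial ι ℂ := fun a => q a
  let y := hp.adjugate.mulVec qv
  refine ⟨∑ a : Fin r, Polynomial.C (y a) * Polynomial.X ^ (a : ℕ), hp.det, ?_⟩
  have hs' : ∀ᶠ z in 𝓝 z0, ∀ a b : Fin r, MvPolynomial.eval z 𝒟.Δ ^ M *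
        ∑ j : Fin r, 1 * 𝒟.τ (σ (f j) z) ^ (a + b : ℕ) = MvPolynomial.eval z (s (a + b)) :=
    eventually_all.2 fun a => eventually_all.2 fun b => hs _ (by omega)
  have hq' : ∀ᶠ z in 𝓝 z0, ∀ a : Fin r, MvPolynomial.eval z 𝒟.Δ ^ M *
        ∑ j : Fin r, F k (σ (f j) z) * 𝒟.τ (σ (f j) z) ^ (a : ℕ) = MvPolynomial.eval z (q a) :=
    eventually_all.2 fun a => hq _ (by omega)
  have hmain : ∀ᶠ z in 𝓝 z0, MvPolynomial.eval z hp.det ≠ 0 ∧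
      F k (σ e0 z) * MvPolynomial.eval z hp.det =
        ev (∑ a : Fin r, Polynomial.C (y a) * Polynomial.X ^ (a : ℕ)) (𝒟.τ (σ e0 z)) z := by
    filter_upwards [hs', hq', hloc, (AD.contΔ z0).eventually_ne hz0] with z h1 h2 h3 h4
    let V := Matrix.vandermonde (fun j : Fin r => 𝒟.τ (σ (f j) z))
    have hV : V.det ≠ 0 := by
      rw [Matrix.det_vandermonde_ne_zero_iff]
      intro i j hij
      have := h3.2.1 (f i).2 (f j).2 hij
      exact f.injective (Subtype.ext this)
    let G := (MvPolynomial.eval z).mapMatrix hp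
    have hG : G = (MvPolynomial.eval z 𝒟.Δ ^ M) • (V.transpose * V) := by
      ext a b
      simp only [G, hp, RingHom.mapMatrix_apply, Matrix.map_apply, Matrix.of_apply]
      rw [← h1 a b]
      simp [V, Matrix.mul_apply, Matrix.vandermonde_apply, pow_add]
    have hg : (fun a => MvPolynomial.eval z (qv a)) = (MvPolynomial.eval z 𝒟.Δ ^ M) •
        (V.transpose.mulVec fun j => F k (σ (f j) z)) := by
      ext a
      simp only [qv]
      rw [← h2 a]
      simp [V, Matrix.mulVec, dotProduct, Matrix.vandermonde_apply, mul_comm]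
    have hint := interp hV hG hg
    have hdet : MvPolynomial.eval z hp.det = G.det := RingHom.map_det _ _
    have hadj : (MvPolynomial.eval z).mapMatrix hp.adjugate = G.adjugate := RingHom.map_adjugate _ _
    refine ⟨?_, ?_⟩
    · rw [hdet, hG, Matrix.det_smul, Matrix.det_mul, Matrix.det_transpose]
      exact mul_ne_zero (pow_ne_zero _ (pow_ne_zero _ h4)) (mul_ne_zero hV hV)
    · have h5 := congrFun hint (f.symm ⟨e0, he0⟩)
      rw [hdet, mul_comm]
      simp only [Pi.smul_apply, smul_eq_mul, Equiv.apply_symm_apply] at h5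
      rw [h5, ← hadj]
      simp only [ev, Polynomial.map_sum, Polynomial.eval_finsetSum, Polynomial.map_mul,
        Polynomial.map_C, Polynomial.map_pow, Polynomial.map_X, Polynomial.eval_mul,
        Polynomial.eval_C, Polynomial.eval_pow, Polynomial.eval_X]
      simp [V, y, Matrix.mulVec, dotProduct, Matrix.vandermonde_apply, mul_comm]
  have hcont : Tendsto 𝒟.Ψ (𝓝 (σ e0 z0)) (𝓝 z0) := by
    have := (AD.anΨ (hσ e0 he0).2.1.1).continuousAt.tendsto
    rwa [(hσ e0 he0).2.2.1] at this
  filter_upwards [hcont.eventually hmain, (hσ e0 he0).2.2.2] with w h1 h2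
  rwa [h2] at h1

end PartP6

section PartQ1

open Polynomial in
lemma clear_den {R K : Type*} [CommRing R] [IsDomain R] [Field K] [Algebra R K] [IsFractionRing R K]
    (p : K[X]) : ∃ (Q : R[X]) (c : R), c ≠ 0 ∧
      Q.map (algebraMap R K) = Polynomial.C (algebraMap R K c) * p := by
  obtain ⟨b, hb⟩ := IsLocalization.integerNormalization_map_to_map (nonZeroDivisors R) p
  refine ⟨IsLocalization.integerNormalization (nonZeroDivisors R) p, b, nonZeroDivisors.ne_zero b.2, ?_⟩
  rw [hb, ← Polynomial.smul_eq_C_mul, algebraMap_smul]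

open Polynomial IntermediateField in
lemma alg1 {R K 𝔐 : Type*} [CommRing R] [IsDomain R] [Field K] [Algebra R K] [IsFractionRing R K]
    [Field 𝔐] [Algebra R 𝔐] [Algebra K 𝔐] [IsScalarTower R K 𝔐] [CharZero K]
    {X : Set 𝔐} (hXf : X.Finite) (hX : ∀ x ∈ X, IsAlgebraic R x)
    {ι : Type*} [Fintype ι] [DecidableEq ι] (J : Matrix ι ι 𝔐)
    (hJ : ∀ i j, J i j ∈ IntermediateField.adjoin K X) (hdet : J.det ≠ 0)
    {l : Type*} [Fintype l] (y : l → 𝔐) (hy : ∀ i, IsAlgebraic R (y i)) :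
    ∃ τ ∈ Algebra.adjoin R X, ∃ (P : R[X]) (Δ : R) (Cm : ι → ι → R[X]) (Γ : l → R[X]),
      Δ ≠ 0 ∧ Polynomial.aeval τ P = 0 ∧ P.leadingCoeff ∣ Δ ∧
      (∃ (a b : R[X]) (d : R), a * P + b * derivative P = Polynomial.C d ∧ d ∣ Δ) ∧
      (∀ q p, ∑ k, Polynomial.aeval τ (Cm q k) * J k p = if q = p then algebraMap R 𝔐 Δ else 0) ∧
      ∀ i, Polynomial.aeval (y i) (Γ i) = 0 ∧ (Γ i).leadingCoeff ∣ Δ := by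
  classical
  have hX' : ∀ x ∈ X, IsIntegral K x := fun x hx =>
    ((IsFractionRing.isAlgebraic_iff R K 𝔐).1 (hX x hx)).isIntegral
  set L := IntermediateField.adjoin K X with hL
  have hLfin : FiniteDimensional K L := by
    have : Finite X := hXf
    exact IntermediateField.finiteDimensional_adjoin hX'
  obtain ⟨α, hα⟩ := Field.exists_primitive_element K L
  have hLalg : L.toSubalgebra = Algebra.adjoin K X :=
    IntermediateField.adjoin_toSubalgebra_of_isAlgebraic fun x hx => (IsFractionRing.isAlgebraic_iff R K 𝔐).1 (hX x hx)
  have hαm : (α : 𝔐) ∈ Algebra.adjoin K X := by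
    rw [← hLalg]; exact α.2
  have hclear : ∀ x ∈ Algebra.adjoin K X, ∃ b : R, b ≠ 0 ∧
      algebraMap R 𝔐 b * x ∈ Algebra.adjoin R X := by
    intro x hx
    induction hx using Algebra.adjoin_induction with
    | mem x hx => exact ⟨1, one_ne_zero, by simpa using Algebra.subset_adjoin hx⟩
    | algebraMap r =>
      obtain ⟨a, b, hb, rfl⟩ := IsFractionRing.div_surjective (A := R) r
      have hb0 : algebraMap R K b ≠ 0 := IsFractionRing.to_map_ne_zero_of_mem_nonZeroDivisors hb
      refine ⟨b, nonZeroDivisors.ne_zero hb, ?_⟩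
      rw [IsScalarTower.algebraMap_apply R K 𝔐, ← map_mul, mul_div_cancel₀ _ hb0,
        ← IsScalarTower.algebraMap_apply]
      exact Subalgebra.algebraMap_mem _ _
    | add x y _ _ hx hy =>
      obtain ⟨b, hb, h⟩ := hx
      obtain ⟨b', hb', h'⟩ := hy
      refine ⟨b * b', mul_ne_zero hb hb', ?_⟩
      have := Subalgebra.add_mem _ (Subalgebra.smul_mem _ h b') (Subalgebra.smul_mem _ h' b)
      convert this using 1
      simp only [Algebra.smul_def, map_mul]; ring
    | mul x y _ _ hx hy =>
      obtain ⟨b, hb, h⟩ := hx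
      obtain ⟨b', hb', h'⟩ := hy
      refine ⟨b * b', mul_ne_zero hb hb', ?_⟩
      have := Subalgebra.mul_mem _ h h'
      convert this using 1
      simp only [map_mul]; ring
  obtain ⟨b, hb0, hb⟩ := hclear _ hαm
  have hbK : algebraMap R K b ≠ 0 := by
    simpa using hb0
  set τ : L := algebraMap K L (algebraMap R K b) * α with hτ
  have hτm : (τ : 𝔐) = algebraMap R 𝔐 b * α := by
    rw [hτ, IsScalarTower.algebraMap_apply R K 𝔐]; rfl
  have hτtop : K⟮τ⟯ = ⊤ := by
    rw [← top_le_iff, ← hα]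
    rw [IntermediateField.adjoin_simple_le_iff]
    have : α = algebraMap K L (algebraMap R K b)⁻¹ * τ := by
      rw [hτ, ← mul_assoc, ← map_mul, inv_mul_cancel₀ hbK, map_one, one_mul]
    rw [this]
    exact mul_mem (IntermediateField.algebraMap_mem _ _) (IntermediateField.mem_adjoin_simple_self K τ)
  have hτint : IsIntegral K τ := Algebra.IsIntegral.isIntegral τ
  have hgen : ∀ x : L, ∃ (Q : R[X]) (c : R), c ≠ 0 ∧
      Polynomial.aeval (τ : 𝔐) Q = algebraMap R 𝔐 c * (x : 𝔐) := by
    intro x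
    have hx : x ∈ K⟮τ⟯ := by rw [hτtop]; trivial
    rw [← IntermediateField.mem_toSubalgebra,
      IntermediateField.adjoin_simple_toSubalgebra_of_isAlgebraic hτint.isAlgebraic,
      Algebra.adjoin_singleton_eq_range_aeval] at hx
    obtain ⟨p, hp⟩ := hx
    obtain ⟨Q, c, hc, hQ⟩ := clear_den (R := R) p
    refine ⟨Q, c, hc, ?_⟩
    have h1 : Polynomial.aeval (τ : 𝔐) (Q.map (algebraMap R K)) = Polynomial.aeval (τ : 𝔐) Q := Polynomial.aeval_map_algebraMap _ _ _
    have h2 : Polynomial.aeval (τ : 𝔐) p = (x : 𝔐) := by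
      rw [← hp]
      exact (IntermediateField.aeval_coe L τ p)
    rw [← h1, hQ, map_mul, Polynomial.aeval_C, h2, ← IsScalarTower.algebraMap_apply]
  -- minimal polynomial
  obtain ⟨P, c, hc, hP⟩ := clear_den (R := R) (minpoly K τ)
  have hsep : (minpoly K τ).Separable := (minpoly.irreducible hτint).separable
  obtain ⟨a, b', hab⟩ := hsep
  obtain ⟨A1, c1, hc1, hA1⟩ := clear_den (R := R) a
  obtain ⟨B1, c2, hc2, hB1⟩ := clear_den (R := R) b'
  have hinjK : Function.Injective (algebraMap R K) := IsFractionRing.injective R K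
  have hP0 : P ≠ 0 := by
    rintro rfl
    rw [Polynomial.map_zero] at hP
    have := mul_ne_zero (Polynomial.C_ne_zero.2 ((map_ne_zero_iff _ hinjK).2 hc)) (minpoly.ne_zero hτint)
    exact this hP.symm
  have hbez : (Polynomial.C c2 * A1) * P + (Polynomial.C c1 * B1) * derivative P = Polynomial.C (c * c1 * c2) := by
    apply Polynomial.map_injective _ hinjK
    simp only [Polynomial.map_add, Polynomial.map_mul, Polynomial.map_C, ← Polynomial.derivative_map, hP, hA1, hB1,
      Polynomial.derivative_mul, Polynomial.derivative_C, map_mul]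
    linear_combination (Polynomial.C (algebraMap R K c) * Polynomial.C (algebraMap R K c1) * Polynomial.C (algebraMap R K c2)) * hab
  -- inverse matrix
  let JL : Matrix ι ι L := Matrix.of fun i j => ⟨J i j, hJ i j⟩
  have hJL : JL.map (algebraMap L 𝔐) = J := by ext i j; rfl
  have hJLdet : IsUnit JL.det := by
    rw [isUnit_iff_ne_zero]
    intro h
    apply hdet
    rw [← hJL, ← RingHom.mapMatrix_apply, ← RingHom.map_det, h, map_zero]
  have hinv := Matrix.nonsing_inv_mul JL hJLdet
  have hinv' : ∀ q p, ∑ k, ((JL⁻¹ q k : L) : 𝔐) * J k p = if q = p then 1 else 0 := by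
    intro q p
    have h1 := congrArg (fun M : Matrix ι ι L => ((M q p : L) : 𝔐)) hinv
    simp only [Matrix.mul_apply, Matrix.one_apply] at h1
    rw [AddSubmonoidClass.coe_finset_sum] at h1
    rw [show (((if q = p then 1 else 0 : L)) : 𝔐) = if q = p then 1 else 0 by split_ifs <;> rfl] at h1
    exact h1
  choose C0 d hd hC0 using fun q k => hgen (JL⁻¹ q k)
  choose Γ hΓ0 hΓ using hy
  set Δ : R := P.leadingCoeff * (c * c1 * c2) * (∏ i, (Γ i).leadingCoeff) * ∏ q, ∏ k, d q k with hΔ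
  have hdvd : ∀ q k, d q k ∣ Δ := fun q k =>
    ((Finset.dvd_prod_of_mem (fun k => d q k) (Finset.mem_univ k)).trans
      (Finset.dvd_prod_of_mem (fun q => ∏ k, d q k) (Finset.mem_univ q))).trans (Dvd.intro_left _ rfl)
  choose e he using hdvd
  refine ⟨τ, by rw [hτm]; exact hb, P, Δ, fun q k => Polynomial.C (e q k) * C0 q k, Γ, ?_, ?_, ?_, ?_, ?_, ?_⟩
  · refine mul_ne_zero (mul_ne_zero (mul_ne_zero (leadingCoeff_ne_zero.2 hP0)
      (mul_ne_zero (mul_ne_zero hc hc1) hc2)) ?_) ?_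
    · exact Finset.prod_ne_zero_iff.2 fun i _ => leadingCoeff_ne_zero.2 (hΓ0 i)
    · exact Finset.prod_ne_zero_iff.2 fun i _ => Finset.prod_ne_zero_iff.2 fun j _ => hd i j
  · have h1 : Polynomial.aeval (τ : 𝔐) (P.map (algebraMap R K)) = Polynomial.aeval (τ : 𝔐) P := Polynomial.aeval_map_algebraMap _ _ _
    have h2 : Polynomial.aeval (τ : 𝔐) (minpoly K τ) = 0 := by
      rw [IntermediateField.aeval_coe, minpoly.aeval]; rfl
    rw [← h1, hP, map_mul, h2, mul_zero]
  · exact ⟨(c * c1 * c2) * (∏ i, (Γ i).leadingCoeff) * ∏ q, ∏ k, d q k, by rw [hΔ]; ring⟩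
  · exact ⟨_, _, _, hbez, ⟨P.leadingCoeff * (∏ i, (Γ i).leadingCoeff) * ∏ q, ∏ k, d q k, by rw [hΔ]; ring⟩⟩
  · intro q p
    have h1 : ∀ k, Polynomial.aeval (τ : 𝔐) (Polynomial.C (e q k) * C0 q k) * J k p =
        algebraMap R 𝔐 Δ * (((JL⁻¹ q k : L) : 𝔐) * J k p) := by
      intro k
      rw [map_mul, Polynomial.aeval_C, hC0, he q k, map_mul]; ring
    rw [Finset.sum_congr rfl fun k _ => h1 k, ← Finset.mul_sum, hinv']
    simp
  · intro i
    refine ⟨hΓ i, ?_⟩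
    refine (Finset.dvd_prod_of_mem (fun i => (Γ i).leadingCoeff) (Finset.mem_univ i)).trans ?_
    exact ⟨P.leadingCoeff * (c * c1 * c2) * ∏ q, ∏ k, d q k, by rw [hΔ]; ring⟩

end PartQ1

section PartQ2

open Polynomial IntermediateField in
lemma alg2 {R A : Type*} [CommRing R] [IsDomain R] [CharZero R] [CommRing A] [IsDomain A]
    [Algebra R A] (hinj : Function.Injective (algebraMap R A))
    {X : Set A} (hXf : X.Finite) (hX : ∀ x ∈ X, IsAlgebraic R x)
    {ι : Type*} [Fintype ι] [DecidableEq ι] (J : Matrix ι ι A)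
    (hJ : ∀ i j, ∃ N ∈ Algebra.adjoin R X, ∃ D ∈ Algebra.adjoin R X, D ≠ 0 ∧ D * J i j = N)
    (hdet : J.det ≠ 0)
    {l : Type*} [Fintype l] (y : l → A) (hy : ∀ i, IsAlgebraic R (y i)) :
    ∃ τ ∈ Algebra.adjoin R X, ∃ (P : R[X]) (Δ : R) (Cm : ι → ι → R[X]) (Γ : l → R[X]),
      Δ ≠ 0 ∧ Polynomial.aeval τ P = 0 ∧ P.leadingCoeff ∣ Δ ∧
      (∃ (a b : R[X]) (d : R), a * P + b * derivative P = Polynomial.C d ∧ d ∣ Δ) ∧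
      (∀ q p, ∑ k, Polynomial.aeval τ (Cm q k) * J k p = if q = p then algebraMap R A Δ else 0) ∧
      ∀ i, Polynomial.aeval (y i) (Γ i) = 0 ∧ (Γ i).leadingCoeff ∣ Δ := by
  classical
  have : FaithfulSMul R A := (faithfulSMul_iff_algebraMap_injective R A).2 hinj
  have : FaithfulSMul R (FractionRing A) := by
    rw [faithfulSMul_iff_algebraMap_injective, IsScalarTower.algebraMap_eq R A (FractionRing A)]
    exact (IsFractionRing.injective A (FractionRing A)).comp hinj
  let _ : Algebra (FractionRing R) (FractionRing A) := FractionRing.liftAlgebra R (FractionRing A)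
  have : IsScalarTower R (FractionRing R) (FractionRing A) :=
    FractionRing.isScalarTower_liftAlgebra R (FractionRing A)
  have : CharZero (FractionRing R) := IsFractionRing.charZero R
  set i : A →ₐ[R] FractionRing A := IsScalarTower.toAlgHom R A (FractionRing A) with hi
  have hii : Function.Injective i := IsFractionRing.injective A (FractionRing A)
  have hmap : (Algebra.adjoin R (i '' X)) = (Algebra.adjoin R X).map i := by
    rw [AlgHom.map_adjoin]
  have hsub : ∀ x ∈ Algebra.adjoin R X, i x ∈ IntermediateField.adjoin (FractionRing R) (i '' X) := by
    intro x hx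
    induction hx using Algebra.adjoin_induction with
    | mem x hx => exact IntermediateField.subset_adjoin _ _ ⟨x, hx, rfl⟩
    | algebraMap r =>
      rw [AlgHom.commutes, IsScalarTower.algebraMap_apply R (FractionRing R) (FractionRing A)]
      exact IntermediateField.algebraMap_mem _ _
    | add x y _ _ hx hy => rw [map_add]; exact add_mem hx hy
    | mul x y _ _ hx hy => rw [map_mul]; exact mul_mem hx hy
  obtain ⟨τ', hτ', P, Δ, Cm, Γ, h1, h2, h3, h4, h5, h6⟩ := alg1 (R := R) (K := FractionRing R)
    (𝔐 := FractionRing A) (X := i '' X) (hXf.image _)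
    (by rintro _ ⟨x, hx, rfl⟩; exact (hX x hx).algHom i) (J.map i)
    (by
      intro a b
      obtain ⟨N, hN, D, hD, hD0, h⟩ := hJ a b
      have : J.map i a b = i N / i D := by
        rw [eq_div_iff ((map_ne_zero_iff _ hii).2 hD0), ← h, map_mul, mul_comm]; rfl
      rw [this]
      exact div_mem (hsub _ hN) (hsub _ hD))
    (by
      have : (J.map i).det = i J.det := by
        rw [← AlgHom.mapMatrix_apply, ← AlgHom.map_det]
      rw [this]
      exact (map_ne_zero_iff _ hii).2 hdet)
    (fun l => i (y l)) (fun l => (hy l).algHom i)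
  rw [hmap] at hτ'
  obtain ⟨τ, hτ, rfl⟩ := hτ'
  refine ⟨τ, hτ, P, Δ, Cm, Γ, h1, ?_, h3, h4, ?_, ?_⟩
  · apply hii
    rw [map_zero, ← h2]
    exact (Polynomial.aeval_algHom_apply i τ P).symm
  · intro q p
    apply hii
    have := h5 q p
    rw [map_sum]
    simp only [map_mul]
    rw [show i (if q = p then algebraMap R A Δ else 0) = if q = p then algebraMap R (FractionRing A) Δ else 0 by
      split_ifs <;> simp, ← this]
    refine Finset.sum_congr rfl fun k _ => ?_
    congr 1
    exact (Polynomial.aeval_algHom_apply i τ _).symm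
  · intro l
    refine ⟨?_, (h6 l).2⟩
    apply hii
    rw [map_zero, ← (h6 l).1]
    exact (Polynomial.aeval_algHom_apply i (y l) _).symm

end PartQ2

section PartQ3

open Algebra in
lemma alg3_iff {k A ι : Type*} [Field k] [CommRing A] [Algebra k A] {x : ι → A}
    (hx : AlgebraicIndependent k x) (y : A) :
    IsAlgebraic (Algebra.adjoin k (Set.range x)) y ↔
      ∃ Q : Polynomial (MvPolynomial ι k), Q ≠ 0 ∧
        Q.eval₂ (MvPolynomial.aeval x : MvPolynomial ι k →ₐ[k] A).toRingHom y = 0 := by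
  have key : (algebraMap (Algebra.adjoin k (Set.range x)) A).comp
      (hx.aevalEquiv : MvPolynomial ι k →+* Algebra.adjoin k (Set.range x)) =
      (MvPolynomial.aeval x : MvPolynomial ι k →ₐ[k] A).toRingHom := by
    ext p
    · simp
    · simp
  constructor
  · rintro ⟨Q, hQ, h⟩
    refine ⟨Q.map (hx.aevalEquiv.symm : Algebra.adjoin k (Set.range x) →+* MvPolynomial ι k), ?_, ?_⟩
    · rwa [Ne, Polynomial.map_eq_zero_iff]
      exact hx.aevalEquiv.symm.injective
    · rw [Polynomial.eval₂_map, ← key, RingHom.comp_assoc, ← h, Polynomial.aeval_def]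
      congr 1
      ext x
      simp
  · rintro ⟨Q, hQ, h⟩
    refine ⟨Q.map (hx.aevalEquiv : MvPolynomial ι k →+* Algebra.adjoin k (Set.range x)), ?_, ?_⟩
    · rwa [Ne, Polynomial.map_eq_zero_iff]
      exact hx.aevalEquiv.injective
    · rw [Polynomial.aeval_def, Polynomial.eval₂_map, key, h]

open Algebra in
lemma alg3 {k A ι : Type*} [Field k] [CommRing A] [IsDomain A] [Algebra k A] [Finite ι] {x x' : ι → A}
    (hx : AlgebraicIndependent k x) (hx' : AlgebraicIndependent k x')
    (h : ∀ i, IsAlgebraic (Algebra.adjoin k (Set.range x')) (x i)) (i : ι) :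
    IsAlgebraic (Algebra.adjoin k (Set.range x)) (x' i) := by
  have hf : (Set.range x).Finite := Set.finite_range x
  have hf' : (Set.range x').Finite := Set.finite_range x'
  set M := AlgebraicIndependent.matroid k A
  have h1 : M.Indep (Set.range x) := hx.coe_range
  have h2 : M.Indep (Set.range x') := hx'.coe_range
  have hsub : Set.range x ⊆ M.closure (Set.range x') := by
    rintro _ ⟨i, rfl⟩
    rw [AlgebraicIndependent.matroid_closure_eq]
    exact h i
  have hcard : (Set.range x').encard = (Set.range x).encard := by
    rw [← Set.image_univ, ← Set.image_univ, hx.injective.encard_image, hx'.injective.encard_image]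
  have hb : M.IsBasis (Set.range x) (M.closure (Set.range x')) := by
    apply Matroid.Indep.isBasis_of_eRk_ge h1 hf hsub
    rw [Matroid.eRk_closure_eq, Matroid.Indep.eRk_eq_encard h2, Matroid.Indep.eRk_eq_encard h1, hcard]
  have : x' i ∈ M.closure (Set.range x) := by
    rw [Matroid.IsBasis.closure_eq_closure hb, Matroid.closure_closure]
    exact M.mem_closure_of_mem ⟨i, rfl⟩
  rw [AlgebraicIndependent.matroid_closure_eq] at this
  exact this

end PartQ3

section PartQ4

open Filter Topology Metric

lemma mvpoly_zero_of_eventually {ι : Type*} [Fintype ι] {p : MvPolynomial ι ℂ} {z : ι → ℂ}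
    (h : ∀ᶠ x in 𝓝 z, MvPolynomial.eval x p = 0) : p = 0 := by
  have h1 : AnalyticOnNhd ℂ (fun x => MvPolynomial.eval x p) Set.univ := fun x _ => analyticAt_mvpoly p x
  have h2 := h1.eqOn_zero_of_preconnected_of_eventuallyEq_zero isPreconnected_univ (Set.mem_univ z) h
  apply MvPolynomial.funext
  intro x
  rw [map_zero]
  exact h2 (Set.mem_univ x)

lemma mvpoly_zero_of_comp {ι : Type*} [Fintype ι] {Ψ : (ι → ℂ) → (ι → ℂ)} {w : ι → ℂ}
    (hΨ : AnalyticAt ℂ Ψ w) (hinj : Function.Injective (fderiv ℂ Ψ w)) {p : MvPolynomial ι ℂ}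
    (h : ∀ᶠ x in 𝓝 w, MvPolynomial.eval (Ψ x) p = 0) : p = 0 := by
  obtain ⟨σ, hσ, hσw, h1, -⟩ := inverse_lemma hΨ hinj
  apply mvpoly_zero_of_eventually (z := Ψ w)
  have h2 : Tendsto σ (𝓝 (Ψ w)) (𝓝 w) := by
    have := hσ.continuousAt.tendsto
    rwa [hσw] at this
  filter_upwards [h1, h2.eventually h] with z hz hz'
  rwa [hz] at hz'

/-- The algebra of functions with denominators powers of `H`. -/
def MFalg {ι : Type*} [Fintype ι] (H : (ι → ℂ) → ℂ) (hH : ∀ w, AnalyticAt ℂ H w) :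
    Subalgebra ℂ ({w // H w ≠ 0} → ℂ) where
  carrier := {f | ∃ F, MF H F ∧ ∀ w, f w = F w}
  mul_mem' := by
    rintro f g ⟨F, hF, h⟩ ⟨G, hG, h'⟩
    exact ⟨_, hF.mul hG, fun w => by simp [h, h']⟩
  add_mem' := by
    rintro f g ⟨F, hF, h⟩ ⟨G, hG, h'⟩
    exact ⟨_, hF.add hH hG, fun w => by simp [h, h']⟩
  algebraMap_mem' := fun c => ⟨_, MF.const c, fun w => by simp⟩

namespace MFalg
variable {ι : Type*} [Fintype ι] {H : (ι → ℂ) → ℂ} {hH : ∀ w, AnalyticAt ℂ H w}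

lemma isDomain (hne : ∃ w, H w ≠ 0) : IsDomain (MFalg H hH) := by
  obtain ⟨w0, hw0⟩ := hne
  have : Nonempty {w // H w ≠ 0} := ⟨⟨w0, hw0⟩⟩
  have : NoZeroDivisors (MFalg H hH) := by
    refine ⟨?_⟩
    rintro ⟨f, F, hF, hf⟩ ⟨g, G, hG, hg⟩ h
    by_contra! hcon
    obtain ⟨h1, h2⟩ := hcon
    apply h1
    have : ∃ w, g w ≠ 0 := by
      by_contra! h3
      apply h2
      ext w
      exact h3 w
    obtain ⟨w1, hw1⟩ := this
    have hz : ∀ w, H w ≠ 0 → F w = 0 := by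
      apply hF.identity hH w1.2
      have hc : ContinuousAt G w1 := (hG.analyticAt hH w1.2).continuousAt
      rw [hg] at hw1
      filter_upwards [hc.eventually_ne hw1, eventually_ne_of_analytic hH w1.2] with w hw hw'
      have := congrArg (fun x : MFalg H hH => x.1 ⟨w, hw'⟩) h
      have h4 : f ⟨w, hw'⟩ * g ⟨w, hw'⟩ = 0 := this
      rw [hf, hg] at h4
      exact (mul_eq_zero.1 h4).resolve_right hw
    ext w
    change f w = 0
    rw [hf]; exact hz _ w.2
  exact NoZeroDivisors.to_isDomain _

/-- Restriction. -/
def mk' {f : (ι → ℂ) → ℂ} (hf : MF H f) : MFalg H hH := ⟨fun w => f w, f, hf, fun _ => rfl⟩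

/-- Evaluation. -/
def at' (w : {w // H w ≠ 0}) : MFalg H hH →ₐ[ℂ] ℂ :=
  (Pi.evalAlgHom ℂ (fun _ : {w // H w ≠ 0} => ℂ) w).comp (MFalg H hH).val

@[simp] lemma at'_mk' (w : {w // H w ≠ 0}) {f : (ι → ℂ) → ℂ} (hf : MF H f) :
    at' w (mk' hf : MFalg H hH) = f w := rfl

lemma ext' {f g : MFalg H hH} (h : ∀ w, at' w f = at' w g) : f = g := by
  ext w; exact h w

lemma exists_mk' (f : MFalg H hH) : ∃ F, ∃ hF : MF H F, f = mk' hF := by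
  obtain ⟨f, F, hF, h⟩ := f
  exact ⟨F, hF, by ext w; exact h w⟩

lemma at'_aeval {κ : Type*} (w : {w // H w ≠ 0}) {f : κ → (ι → ℂ) → ℂ} (hf : ∀ i, MF H (f i))
    (p : MvPolynomial κ ℂ) :
    at' w (MvPolynomial.aeval (fun i => (mk' (hf i) : MFalg H hH)) p) =
      MvPolynomial.eval (fun i => f i w) p := by
  rw [MvPolynomial.comp_aeval_apply]
  simp only [at'_mk']
  rw [MvPolynomial.aeval_eq_eval]

lemma at'_eval₂ {κ : Type*} (w : {w // H w ≠ 0}) {f : κ → (ι → ℂ) → ℂ} (hf : ∀ i, MF H (f i))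
    (x : MFalg H hH) (Q : Polynomial (MvPolynomial κ ℂ)) :
    at' w (Q.eval₂ (MvPolynomial.aeval (fun i => (mk' (hf i) : MFalg H hH)) :
      MvPolynomial κ ℂ →ₐ[ℂ] MFalg H hH).toRingHom x) = ev Q (at' w x) (fun i => f i w) := by
  have h : ((at' w : MFalg H hH →ₐ[ℂ] ℂ) : MFalg H hH →+* ℂ).comp
      (MvPolynomial.aeval (fun i => (mk' (hf i) : MFalg H hH)) :
      MvPolynomial κ ℂ →ₐ[ℂ] MFalg H hH).toRingHom = MvPolynomial.eval (fun i => f i w) := by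
    ext p
    · simp
    · simp
  have h2 := Polynomial.hom_eval₂ Q (MvPolynomial.aeval (fun i => (mk' (hf i) : MFalg H hH)) :
      MvPolynomial κ ℂ →ₐ[ℂ] MFalg H hH).toRingHom ((at' w : MFalg H hH →ₐ[ℂ] ℂ) : MFalg H hH →+* ℂ) x
  rw [h] at h2
  rw [ev, Polynomial.eval_map]
  exact h2

lemma algebraicIndependent {Ψ : (ι → ℂ) → (ι → ℂ)} (hΨ : ∀ i, MF H (fun w => Ψ w i))
    {w : ι → ℂ} (hw : H w ≠ 0) (hinj : Function.Injective (fderiv ℂ Ψ w)) :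
    AlgebraicIndependent ℂ (fun i => (mk' (hΨ i) : MFalg H hH)) := by
  rw [algebraicIndependent_iff]
  intro p hp
  have han : AnalyticAt ℂ Ψ w := AnalyticAt.pi fun i => (hΨ i).analyticAt hH hw
  apply mvpoly_zero_of_comp han hinj
  filter_upwards [eventually_ne_of_analytic hH hw] with x hx
  have := congrArg (at' ⟨x, hx⟩) hp
  rw [at'_aeval, map_zero] at this
  exact this
end MFalg

end PartQ4

section PartQ5

open Filter Topology Metric

lemma AD.build {ι m κ : Type*} [Fintype ι] [DecidableEq ι] [Finite m] [Fintype κ]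
    {H : (ι → ℂ) → ℂ} (hH : ∀ w, AnalyticAt ℂ H w)
    {Ψ : (ι → ℂ) → (ι → ℂ)} (hΨ : ∀ i, MF H (fun w => Ψ w i))
    {w1 : ι → ℂ} (hw1 : H w1 ≠ 0) (hinj : Function.Injective (fderiv ℂ Ψ w1))
    {x : m → (ι → ℂ) → ℂ} (hx : ∀ j, MF H (x j))
    (hxa : ∀ j, ∃ Q : Polynomial (MvPolynomial ι ℂ), Q ≠ 0 ∧
      ∀ w, H w ≠ 0 → ev Q (x j w) (Ψ w) = 0)
    (hJ : ∀ i j, ∃ N D : MvPolynomial (m ⊕ ι) ℂ,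
      (∃ w, H w ≠ 0 ∧ MvPolynomial.eval (Sum.elim (fun j => x j w) (Ψ w)) D ≠ 0) ∧
      ∀ w, H w ≠ 0 → MvPolynomial.eval (Sum.elim (fun j => x j w) (Ψ w)) D *
        fderiv ℂ (fun w => Ψ w i) w (Pi.single j 1) =
        MvPolynomial.eval (Sum.elim (fun j => x j w) (Ψ w)) N)
    {F : κ → (ι → ℂ) → ℂ} (hF : ∀ j, MF H (F j))
    (hFa : ∀ j, ∃ Q : Polynomial (MvPolynomial ι ℂ), Q ≠ 0 ∧
      ∀ w, H w ≠ 0 → ev Q (F j w) (Ψ w) = 0) :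
    ∃ (𝒟 : AD ι) (T : MvPolynomial (m ⊕ ι) ℂ) (Γ : κ → Polynomial (MvPolynomial ι ℂ)),
      𝒟.H = H ∧ 𝒟.Ψ = Ψ ∧
      (𝒟.τ = fun w => MvPolynomial.eval (Sum.elim (fun j => x j w) (Ψ w)) T) ∧
      (∀ k w, H w ≠ 0 → ev (Γ k) (F k w) (Ψ w) = 0) ∧
      (∀ k, (Γ k).leadingCoeff ∣ 𝒟.Δ) ∧ ∃ w, 𝒟.good w := by
  classical
  have hdom : IsDomain (MFalg H hH) := MFalg.isDomain ⟨w1, hw1⟩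
  let z : ι → MFalg H hH := fun i => MFalg.mk' (hΨ i)
  have hz : AlgebraicIndependent ℂ z := MFalg.algebraicIndependent hΨ hw1 hinj
  let _ : Algebra (MvPolynomial ι ℂ) (MFalg H hH) :=
    (MvPolynomial.aeval z : MvPolynomial ι ℂ →ₐ[ℂ] MFalg H hH).toRingHom.toAlgebra
  have halgmap : ∀ p, algebraMap (MvPolynomial ι ℂ) (MFalg H hH) p = MvPolynomial.aeval z p := fun p => rfl
  have hev : ∀ w (y : MFalg H hH) (Q : Polynomial (MvPolynomial ι ℂ)),
      MFalg.at' w (Polynomial.aeval y Q) = ev Q (MFalg.at' w y) (Ψ w) := by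
    intro w y Q
    exact MFalg.at'_eval₂ w hΨ y Q
  have hevm : ∀ w (p : MvPolynomial ι ℂ),
      MFalg.at' w (algebraMap (MvPolynomial ι ℂ) (MFalg H hH) p) = MvPolynomial.eval (Ψ w) p := by
    intro w p
    rw [halgmap, MFalg.at'_aeval]
  let X : Set (MFalg H hH) := Set.range fun j => MFalg.mk' (hx j)
  have hsum : ∀ i : m ⊕ ι, MF H (Sum.elim x (fun i w => Ψ w i) i) := by
    rintro (j | i)
    · exact hx j
    · exact hΨ i
  have hsum2 : ∀ w : ι → ℂ, (fun i => Sum.elim x (fun i w => Ψ w i) i w) =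
      Sum.elim (fun j => x j w) (Ψ w) := by
    intro w; ext (j | i) <;> rfl
  have hfwd : ∀ N : MvPolynomial (m ⊕ ι) ℂ,
      MvPolynomial.aeval (fun i => (MFalg.mk' (hsum i) : MFalg H hH)) N ∈
        Algebra.adjoin (MvPolynomial ι ℂ) X := by
    intro N
    induction N using MvPolynomial.induction_on with
    | C c =>
      have : MvPolynomial.aeval (fun i => (MFalg.mk' (hsum i) : MFalg H hH)) (MvPolynomial.C c) =
          algebraMap (MvPolynomial ι ℂ) (MFalg H hH) (MvPolynomial.C c) := by
        rw [halgmap, MvPolynomial.aeval_C, MvPolynomial.aeval_C]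
      rw [this]; exact Subalgebra.algebraMap_mem _ _
    | add p q hp hq => rw [map_add]; exact add_mem hp hq
    | mul_X p i hp =>
      rw [map_mul]
      refine mul_mem hp ?_
      rw [MvPolynomial.aeval_X]
      rcases i with j | i
      · exact Algebra.subset_adjoin ⟨j, rfl⟩
      · have : (MFalg.mk' (hsum (Sum.inr i)) : MFalg H hH) =
          algebraMap (MvPolynomial ι ℂ) (MFalg H hH) (MvPolynomial.X i) := by
          rw [halgmap, MvPolynomial.aeval_X]; rfl
        rw [this]; exact Subalgebra.algebraMap_mem _ _
  have hfwd2 : ∀ w (N : MvPolynomial (m ⊕ ι) ℂ),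
      MFalg.at' w (MvPolynomial.aeval (fun i => (MFalg.mk' (hsum i) : MFalg H hH)) N) =
      MvPolynomial.eval (Sum.elim (fun j => x j w) (Ψ w)) N := by
    intro w N
    rw [MFalg.at'_aeval, hsum2]
  have hbwd : ∀ a ∈ Algebra.adjoin (MvPolynomial ι ℂ) X, ∃ T : MvPolynomial (m ⊕ ι) ℂ,
      a = MvPolynomial.aeval (fun i => (MFalg.mk' (hsum i) : MFalg H hH)) T := by
    intro a ha
    induction ha using Algebra.adjoin_induction with
    | mem a ha =>
      obtain ⟨j, rfl⟩ := ha
      exact ⟨MvPolynomial.X (Sum.inl j), by rw [MvPolynomial.aeval_X]; rfl⟩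
    | algebraMap p =>
      refine ⟨MvPolynomial.rename Sum.inr p, ?_⟩
      rw [MvPolynomial.aeval_rename]; rfl
    | add a b _ _ ha hb =>
      obtain ⟨S, rfl⟩ := ha
      obtain ⟨T, rfl⟩ := hb
      exact ⟨S + T, by rw [map_add]⟩
    | mul a b _ _ ha hb =>
      obtain ⟨S, rfl⟩ := ha
      obtain ⟨T, rfl⟩ := hb
      exact ⟨S * T, by rw [map_mul]⟩
  have halg : ∀ {f : (ι → ℂ) → ℂ} (hf : MF H f), (∃ Q : Polynomial (MvPolynomial ι ℂ), Q ≠ 0 ∧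
      ∀ w, H w ≠ 0 → ev Q (f w) (Ψ w) = 0) →
      IsAlgebraic (MvPolynomial ι ℂ) (MFalg.mk' hf : MFalg H hH) := by
    rintro f hf ⟨Q, hQ, h⟩
    refine ⟨Q, hQ, MFalg.ext' fun w => ?_⟩
    rw [hev, map_zero]
    exact h w w.2
  have hdΨ : ∀ i j, MF H (fun w => fderiv ℂ (fun w => Ψ w i) w (Pi.single j 1)) := fun i j =>
    (hΨ i).dir hH _
  let J : Matrix ι ι (MFalg H hH) := Matrix.of fun i j => MFalg.mk' (hdΨ i j)
  have hdet : J.det ≠ 0 := by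
    intro h0
    have h1 := congrArg (MFalg.at' ⟨w1, hw1⟩) h0
    rw [map_zero, AlgHom.map_det] at h1
    obtain ⟨v, hv, hv0⟩ := Matrix.exists_mulVec_eq_zero_iff.2 h1
    apply hv
    apply hinj
    rw [map_zero]
    have hd : DifferentiableAt ℂ Ψ w1 := (AnalyticAt.pi fun i => (hΨ i).analyticAt hH hw1).differentiableAt
    ext i
    have h2 := congrFun hv0 i
    rw [Pi.zero_apply] at h2
    rw [Pi.zero_apply, ← h2]
    have h3 : fderiv ℂ Ψ w1 v i = fderiv ℂ (fun w => Ψ w i) w1 v := by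
      rw [fderiv_apply hd]; rfl
    rw [h3]
    have h4 : v = ∑ j, v j • Pi.single j (1 : ℂ) := by
      ext i; simp [Finset.sum_apply, Pi.single_apply]
    conv_lhs => rw [h4]
    rw [map_sum, Matrix.mulVec, dotProduct]
    refine Finset.sum_congr rfl fun j _ => ?_
    rw [map_smul, smul_eq_mul, mul_comm]
    rfl
  obtain ⟨τ, hτ, P, Δ, Cm, Γ, h1, h2, h3, h4, h5, h6⟩ := alg2 (R := MvPolynomial ι ℂ) (A := MFalg H hH)
    hz (X := X) (Set.finite_range _) (by rintro _ ⟨j, rfl⟩; exact halg (hx j) (hxa j)) J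
    (by
      intro i j
      obtain ⟨N, D, ⟨w, hw, hD⟩, h⟩ := hJ i j
      refine ⟨_, hfwd N, _, hfwd D, ?_, ?_⟩
      · intro h0
        apply hD
        rw [← hfwd2 ⟨w, hw⟩, h0, map_zero]
      · apply MFalg.ext'
        intro w
        rw [map_mul, hfwd2, hfwd2, ← h w w.2]
        rfl)
    hdet (fun j => MFalg.mk' (hF j)) (fun j => halg (hF j) (hFa j))
  obtain ⟨T, rfl⟩ := hbwd τ hτ
  refine ⟨{ H := H, Ψ := Ψ, τ := fun w => MvPolynomial.eval (Sum.elim (fun j => x j w) (Ψ w)) T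
            P := P, Δ := Δ, Cm := Cm, hH := hH, hΨ := hΨ, hτ := ?_, hP := ?_, hsep := ?_
            hlc := h3, hC := ?_ }, T, Γ, rfl, rfl, rfl, ?_, ?_, ?_⟩
  · refine (MF.mvpoly hH hsum T).congr fun w hw => ?_
    rw [hsum2]
  · intro w hw
    have := congrArg (MFalg.at' ⟨w, hw⟩) h2
    rwa [hev, map_zero, hfwd2] at this
  · intro z hz
    obtain ⟨a, b, d, hab, e, rfl⟩ := h4
    have hd : MvPolynomial.eval z d ≠ 0 := by
      rw [map_mul] at hz
      exact left_ne_zero_of_mul hz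
    have h7 := congrArg (Polynomial.map (MvPolynomial.eval z)) hab
    rw [Polynomial.map_add, Polynomial.map_mul, Polynomial.map_mul, Polynomial.map_C,
      ← Polynomial.derivative_map] at h7
    refine ⟨Polynomial.C (MvPolynomial.eval z d)⁻¹ * a.map (MvPolynomial.eval z),
      Polynomial.C (MvPolynomial.eval z d)⁻¹ * b.map (MvPolynomial.eval z), ?_⟩
    rw [mul_assoc, mul_assoc, ← mul_add, h7, ← Polynomial.C_mul, inv_mul_cancel₀ hd, Polynomial.C_1]
  · intro w hw q p
    have := congrArg (MFalg.at' ⟨w, hw⟩) (h5 q p)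
    rw [map_sum] at this
    simp only [map_mul, hev, hfwd2] at this
    rw [apply_ite (MFalg.at' ⟨w, hw⟩), hevm, map_zero] at this
    exact this
  · intro k w hw
    have := congrArg (MFalg.at' ⟨w, hw⟩) (h6 k).1
    rwa [hev, map_zero] at this
  · exact fun k => (h6 k).2
  · by_contra! hcon
    apply h1
    apply hz
    rw [map_zero]
    apply MFalg.ext'
    intro w
    rw [map_zero]
    have := hevm w Δ
    rw [halgmap] at this
    rw [this]
    by_contra h
    exact hcon w ⟨w.2, h⟩

end PartQ5

section PartQ6

open Filter Topology Metric

lemma exchange {ι : Type*} [Fintype ι]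
    {H : (ι → ℂ) → ℂ} (hH : ∀ w, AnalyticAt ℂ H w)
    {Ψ Ψ' : (ι → ℂ) → (ι → ℂ)} (hΨ : ∀ i, MF H (fun w => Ψ w i)) (hΨ' : ∀ i, MF H (fun w => Ψ' w i))
    {w1 w2 : ι → ℂ} (hw1 : H w1 ≠ 0) (hinj : Function.Injective (fderiv ℂ Ψ w1))
    (hw2 : H w2 ≠ 0) (hinj' : Function.Injective (fderiv ℂ Ψ' w2))
    (h : ∀ i, ∃ Q : Polynomial (MvPolynomial ι ℂ), Q ≠ 0 ∧ ∀ w, H w ≠ 0 → ev Q (Ψ w i) (Ψ' w) = 0)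
    (i : ι) :
    ∃ Q : Polynomial (MvPolynomial ι ℂ), Q ≠ 0 ∧ ∀ w, H w ≠ 0 → ev Q (Ψ' w i) (Ψ w) = 0 := by
  have hdom : IsDomain (MFalg H hH) := MFalg.isDomain ⟨w1, hw1⟩
  have hz : AlgebraicIndependent ℂ (fun i => (MFalg.mk' (hΨ i) : MFalg H hH)) :=
    MFalg.algebraicIndependent hΨ hw1 hinj
  have hz' : AlgebraicIndependent ℂ (fun i => (MFalg.mk' (hΨ' i) : MFalg H hH)) :=
    MFalg.algebraicIndependent hΨ' hw2 hinj'
  have h1 := alg3 hz hz' (fun i => by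
    rw [alg3_iff hz']
    obtain ⟨Q, hQ, hQ'⟩ := h i
    refine ⟨Q, hQ, MFalg.ext' fun w => ?_⟩
    rw [MFalg.at'_eval₂, map_zero]
    exact hQ' w w.2) i
  rw [alg3_iff hz] at h1
  obtain ⟨Q, hQ, hQ'⟩ := h1
  refine ⟨Q, hQ, fun w hw => ?_⟩
  have := congrArg (MFalg.at' ⟨w, hw⟩) hQ'
  rw [MFalg.at'_eval₂, map_zero] at this
  exact this

lemma exists_ne_of_eventually {E : Type*} [NormedAddCommGroup E] [NormedSpace ℂ E]
    {H : E → ℂ} (hH : ∀ w, AnalyticAt ℂ H w) (hne : ∃ w, H w ≠ 0) {w0 : E} {p : E → Prop}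
    (hp : ∀ᶠ w in 𝓝 w0, p w) : ∃ w, H w ≠ 0 ∧ p w := by
  by_contra! hcon
  obtain ⟨w1, hw1⟩ := hne
  apply hw1
  have h1 : AnalyticOnNhd ℂ H Set.univ := fun x _ => hH x
  have h2 : H =ᶠ[𝓝 w0] 0 := by
    filter_upwards [hp] with w hw
    by_contra h
    exact hcon w h hw
  exact h1.eqOn_zero_of_preconnected_of_eventuallyEq_zero isPreconnected_univ (Set.mem_univ w0) h2
    (Set.mem_univ w1)

lemma entire_mul_ne {E : Type*} [NormedAddCommGroup E] [NormedSpace ℂ E]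
    {f g : E → ℂ} (hf : ∀ w, AnalyticAt ℂ f w) (hg : ∀ w, AnalyticAt ℂ g w)
    (hfn : ∃ w, f w ≠ 0) (hgn : ∃ w, g w ≠ 0) : ∃ w, f w * g w ≠ 0 := by
  obtain ⟨w0, hw0⟩ := hgn
  obtain ⟨w, h1, h2⟩ := exists_ne_of_eventually hf hfn ((hg w0).continuousAt.eventually_ne hw0)
  exact ⟨w, mul_ne_zero h1 h2⟩

lemma entire_prod_ne {E κ : Type*} [NormedAddCommGroup E] [NormedSpace ℂ E]
    {f : κ → E → ℂ} (hf : ∀ k w, AnalyticAt ℂ (f k) w) (hfn : ∀ k, ∃ w, f k w ≠ 0) (s : Finset κ) :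
    ∃ w, ∏ k ∈ s, f k w ≠ 0 := by
  classical
  induction s using Finset.induction_on with
  | empty => exact ⟨0, by simp⟩
  | insert a s ha ih =>
    simp only [Finset.prod_insert ha]
    exact entire_mul_ne (hf a) (fun w => Finset.analyticAt_fun_prod s fun k _ => hf k w) (hfn a) ih

lemma MF.of_mul {ι : Type*} [Fintype ι] {H H' K f : (ι → ℂ) → ℂ} (hf : MF H f)
    (hK : ∀ w, AnalyticAt ℂ K w) (h : ∀ w, H' w = H w * K w) : MF H' f := by
  have : H' = fun w => H w * K w := funext h
  rw [this]
  exact hf.mono hK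

lemma ev_option {σ ι : Type*} (f : σ → ι) (V : MvPolynomial (Option σ) ℂ) (x : ℂ) (z : ι → ℂ) :
    ev ((MvPolynomial.optionEquivLeft ℂ σ V).map
      (MvPolynomial.rename f : MvPolynomial σ ℂ →ₐ[ℂ] MvPolynomial ι ℂ).toRingHom) x z =
    MvPolynomial.eval (fun i => i.elim x fun j => z (f j)) V := by
  rw [ev]
  induction V using MvPolynomial.induction_on with
  | C c => simp [MvPolynomial.optionEquivLeft_C]
  | add p q hp hq => simp only [map_add, Polynomial.map_add, Polynomial.eval_add, hp, hq]
  | mul_X p i hp =>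
    rw [map_mul, Polynomial.map_mul, Polynomial.map_mul, Polynomial.eval_mul, hp, map_mul]
    congr 1
    cases i <;> simp [MvPolynomial.optionEquivLeft_X_none, MvPolynomial.optionEquivLeft_X_some]

lemma option_map_ne_zero {σ ι : Type*} {f : σ → ι} (hf : Function.Injective f)
    {V : MvPolynomial (Option σ) ℂ} (hV : V ≠ 0) :
    ((MvPolynomial.optionEquivLeft ℂ σ V).map
      (MvPolynomial.rename f : MvPolynomial σ ℂ →ₐ[ℂ] MvPolynomial ι ℂ).toRingHom) ≠ 0 := by
  rw [Ne, Polynomial.map_eq_zero_iff, map_eq_zero_iff]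
  · exact hV
  · exact (MvPolynomial.optionEquivLeft ℂ σ).injective
  · exact MvPolynomial.rename_injective f hf

lemma eval_eval₂_ev {m ι : Type*} (Q : Polynomial (MvPolynomial ι ℂ)) (T : MvPolynomial (m ⊕ ι) ℂ)
    (x : m → ℂ) (z : ι → ℂ) :
    MvPolynomial.eval (Sum.elim x z) (Q.eval₂
      (MvPolynomial.rename Sum.inr : MvPolynomial ι ℂ →ₐ[ℂ] MvPolynomial (m ⊕ ι) ℂ).toRingHom T) =
    ev Q (MvPolynomial.eval (Sum.elim x z) T) z := by
  rw [ev, Polynomial.eval_map, Polynomial.hom_eval₂]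
  congr 1
  ext p
  · simp
  · simp

end PartQ6

section PartQ7

open Filter Topology Metric

lemma pd_det_inj {n : ℕ} {φ : Fin n → (Fin n → ℂ) → ℂ} {u : Fin n → ℂ}
    (hdet : Matrix.det (Matrix.of fun k p => pd (φ k) p u) ≠ 0) {v : Fin n → ℂ}
    (hv : ∀ k, fderiv ℂ (φ k) u v = 0) : v = 0 := by
  by_contra hv0
  apply hdet
  apply Matrix.exists_mulVec_eq_zero_iff.1
  refine ⟨v, hv0, ?_⟩
  ext k
  rw [Pi.zero_apply, ← hv k]
  have h4 : v = ∑ j, v j • Pi.single j (1 : ℂ) := by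
    ext i; simp [Finset.sum_apply, Pi.single_apply]
  conv_rhs => rw [h4]
  rw [map_sum, Matrix.mulVec, dotProduct]
  refine Finset.sum_congr rfl fun j _ => ?_
  rw [map_smul, smul_eq_mul, mul_comm]
  rfl

lemma fderiv_comp_clm {n : ℕ} {E : Type*} [NormedAddCommGroup E] [NormedSpace ℂ E]
    {f : (Fin n → ℂ) → ℂ} (L : E →L[ℂ] (Fin n → ℂ)) {w : E} (hf : AnalyticAt ℂ f (L w)) (v : E) :
    fderiv ℂ (fun w => f (L w)) w v = fderiv ℂ f (L w) (L v) := by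
  have h := fderiv_comp w hf.differentiableAt L.differentiableAt
  have h2 : (fun w => f (L w)) = f ∘ L := rfl
  rw [h2, h, L.fderiv]
  rfl

/-- The map given by `φ` along two linear maps. -/
def Psi {n : ℕ} (φ : Fin n → (Fin n → ℂ) → ℂ) {E : Type*} (L1 L2 : E → (Fin n → ℂ)) (w : E) :
    Fin n ⊕ Fin n → ℂ :=
  Sum.elim (fun k => φ k (L1 w)) (fun k => φ k (L2 w))

lemma Psi_inj {n : ℕ} {φ : Fin n → (Fin n → ℂ) → ℂ} {E : Type*} [NormedAddCommGroup E]
    [NormedSpace ℂ E] {L1 L2 : E →L[ℂ] (Fin n → ℂ)} (hL : ∀ w, L1 w = 0 → L2 w = 0 → w = 0) {w : E}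
    (h1 : ∀ k, AnalyticAt ℂ (φ k) (L1 w)) (h2 : ∀ k, AnalyticAt ℂ (φ k) (L2 w))
    (hd1 : Matrix.det (Matrix.of fun k p => pd (φ k) p (L1 w)) ≠ 0)
    (hd2 : Matrix.det (Matrix.of fun k p => pd (φ k) p (L2 w)) ≠ 0) :
    Function.Injective (fderiv ℂ (Psi φ L1 L2) w) := by
  have han : ∀ i, DifferentiableAt ℂ (fun w => Psi φ L1 L2 w i) w := by
    rintro (k | k)
    · exact (h1 k).differentiableAt.comp w L1.differentiableAt
    · exact (h2 k).differentiableAt.comp w L2.differentiableAt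
  have hd : DifferentiableAt ℂ (Psi φ L1 L2) w := differentiableAt_pi.2 han
  rw [injective_iff_map_eq_zero]
  intro v hv
  have h3 : ∀ i, fderiv ℂ (fun w => Psi φ L1 L2 w i) w v = 0 := by
    intro i
    have := congrFun hv i
    rw [fderiv_apply hd]
    exact this
  apply hL
  · apply pd_det_inj hd1
    intro k
    rw [← fderiv_comp_clm L1 (h1 k)]
    exact h3 (Sum.inl k)
  · apply pd_det_inj hd2
    intro k
    rw [← fderiv_comp_clm L2 (h2 k)]
    exact h3 (Sum.inr k)

lemma pd_analyticAt {n : ℕ} {f : (Fin n → ℂ) → ℂ} {u : Fin n → ℂ} (hf : AnalyticAt ℂ f u)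
    (p : Fin n) : AnalyticAt ℂ (pd f p) u := by
  have h := hf.fderiv
  exact (ContinuousLinearMap.apply ℂ ℂ (Pi.single p (1 : ℂ) : Fin n → ℂ)).analyticAt _ |>.comp h

lemma det_eventually {n : ℕ} {φ : Fin n → (Fin n → ℂ) → ℂ} {u : Fin n → ℂ}
    (h : ∀ j, AnalyticAt ℂ (φ j) u)
    (hdet : Matrix.det (Matrix.of fun k p => pd (φ k) p u) ≠ 0) :
    ∀ᶠ x in 𝓝 u, (∀ j, AnalyticAt ℂ (φ j) x) ∧
      Matrix.det (Matrix.of fun k p => pd (φ k) p x) ≠ 0 := by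
  have hc : ContinuousAt (fun x => Matrix.det (Matrix.of fun k p => pd (φ k) p x)) u := by
    simp only [Matrix.det_apply]
    apply tendsto_finset_sum
    intro σ _
    apply Tendsto.const_smul
    apply tendsto_finset_prod
    intro i _
    exact (pd_analyticAt (h _) _).continuousAt
  filter_upwards [hc.eventually_ne hdet, eventually_all.2 fun j => (h j).eventually_analyticAt]
    with x h1 h2 using ⟨h2, h1⟩

/-- Which side. -/
def sd {n : ℕ} (b : Bool) : Fin n → Fin n ⊕ Fin n := if b then Sum.inl else Sum.inr

lemma sd_inj {n : ℕ} (b : Bool) : Function.Injective (sd b : Fin n → _) := by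
  cases b
  · exact Sum.inr_injective
  · exact Sum.inl_injective

/-- Coordinate projection. -/
noncomputable def Lc {n : ℕ} (b : Bool) : (Fin n ⊕ Fin n → ℂ) →L[ℂ] (Fin n → ℂ) :=
  ContinuousLinearMap.pi fun j => ContinuousLinearMap.proj (sd b j)

lemma Lc_apply {n : ℕ} (b : Bool) (w : Fin n ⊕ Fin n → ℂ) (j : Fin n) : Lc b w j = w (sd b j) := rfl

lemma Lc_elim_true {n : ℕ} (u v : Fin n → ℂ) : Lc true (Sum.elim u v) = u := rfl
lemma Lc_elim_false {n : ℕ} (u v : Fin n → ℂ) : Lc false (Sum.elim u v) = v := rfl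

lemma Lc_ext {n : ℕ} {w : Fin n ⊕ Fin n → ℂ} (h1 : Lc true w = 0) (h2 : Lc false w = 0) : w = 0 := by
  ext (j | j)
  · exact congrFun h1 j
  · exact congrFun h2 j

lemma Lc_single {n : ℕ} (b b' : Bool) (p : Fin n) :
    Lc b (Pi.single (sd b' p) 1) = if b = b' then Pi.single p 1 else 0 := by
  ext j
  rw [Lc_apply]
  cases b <;> cases b' <;> simp [sd, Pi.single_apply]

lemma Psi_sd {n : ℕ} (φ : Fin n → (Fin n → ℂ) → ℂ) (b : Bool) (k : Fin n) (w : Fin n ⊕ Fin n → ℂ) :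
    Psi φ (Lc true) (Lc false) w (sd b k) = φ k (Lc b w) := by
  cases b <;> rfl

lemma sd_cases {n : ℕ} (i : Fin n ⊕ Fin n) : ∃ b k, i = sd b k := by
  rcases i with k | k
  · exact ⟨true, k, rfl⟩
  · exact ⟨false, k, rfl⟩

end PartQ7

section PartQ8

open Filter Topology Metric

lemma entire_shift_ne {E : Type*} [NormedAddCommGroup E] [NormedSpace ℂ E] {h0 : E → ℂ}
    (hne : ∃ u, h0 u ≠ 0) (c : E) : ∃ u, h0 (u + c) ≠ 0 := by
  obtain ⟨u, hu⟩ := hne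
  exact ⟨u - c, by simpa using hu⟩

lemma an_shift {E : Type*} [NormedAddCommGroup E] [NormedSpace ℂ E] {h0 : E → ℂ}
    (hh : ∀ u, AnalyticAt ℂ h0 u) (c u : E) : AnalyticAt ℂ (fun u => h0 (u + c)) u :=
  AnalyticAt.fun_comp (hh _) (analyticAt_id.add analyticAt_const)

lemma an_refl {E : Type*} [NormedAddCommGroup E] [NormedSpace ℂ E] {h0 : E → ℂ}
    (hh : ∀ u, AnalyticAt ℂ h0 u) (c u : E) : AnalyticAt ℂ (fun u => h0 (c - u)) u :=
  AnalyticAt.fun_comp (hh _) (analyticAt_const.sub analyticAt_id)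

lemma entire_refl_ne {E : Type*} [NormedAddCommGroup E] [NormedSpace ℂ E] {h0 : E → ℂ}
    (hne : ∃ u, h0 u ≠ 0) (c : E) : ∃ u, h0 (c - u) ≠ 0 := by
  obtain ⟨u, hu⟩ := hne
  exact ⟨c - u, by simpa using hu⟩

lemma period_sub {n : ℕ} {h0 f : (Fin n → ℂ) → ℂ} (hh : ∀ u, AnalyticAt ℂ h0 u)
    (hne : ∃ u, h0 u ≠ 0) (hf : MF h0 f) {ω1 ω2 : Fin n → ℂ}
    (h1 : ∀ u, h0 u ≠ 0 → h0 (u + ω1) ≠ 0 → f (u + ω1) = f u)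
    (h2 : ∀ u, h0 u ≠ 0 → h0 (u + ω2) ≠ 0 → f (u + ω2) = f u)
    (s : Fin n → ℂ) (hs : h0 s ≠ 0) (hs' : h0 (s + (ω1 - ω2)) ≠ 0) :
    f (s + (ω1 - ω2)) = f s := by
  have hH' : ∀ u, AnalyticAt ℂ (fun u => h0 u * h0 (u + (ω1 - ω2))) u := fun u =>
    (hh u).mul (an_shift hh _ u)
  have hH'ne : ∃ u, h0 u * h0 (u + (ω1 - ω2)) ≠ 0 :=
    entire_mul_ne hh (an_shift hh _) hne (entire_shift_ne hne _)
  have hf1 : MF (fun u => h0 u * h0 (u + (ω1 - ω2))) f := hf.mono (an_shift hh _)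
  have hf2 : MF (fun u => h0 u * h0 (u + (ω1 - ω2))) (fun u => f (u + (ω1 - ω2))) := by
    have : MF (fun u => h0 (u + (ω1 - ω2))) (fun u => f (u + (ω1 - ω2))) :=
      MF.comp (L := fun u => u + (ω1 - ω2)) (fun w => analyticAt_id.add analyticAt_const) hf
    exact this.of_mul hh fun w => mul_comm _ _
  obtain ⟨s1, hs1⟩ := entire_mul_ne hH' (an_shift hh (-ω2)) hH'ne (entire_shift_ne hne _)
  have hz := (hf2.sub hH' hf1).identity hH' (w0 := s1) (left_ne_zero_of_mul hs1) (by
    have hc : ContinuousAt (fun u => h0 u * h0 (u + (ω1 - ω2)) * h0 (u + -ω2)) s1 :=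
      ((hH' s1).mul (an_shift hh _ s1)).continuousAt
    filter_upwards [hc.eventually_ne hs1] with x hx
    have hx1 := left_ne_zero_of_mul (left_ne_zero_of_mul hx)
    have hx2 := right_ne_zero_of_mul (left_ne_zero_of_mul hx)
    have hx3 := right_ne_zero_of_mul hx
    have e1 : x + -ω2 + ω2 = x := by abel
    have e2 : x + -ω2 + ω1 = x + (ω1 - ω2) := by abel
    have k1 := h2 (x + -ω2) hx3 (by rwa [e1])
    have k2 := h1 (x + -ω2) hx3 (by rwa [e2])
    rw [e1] at k1
    rw [e2] at k2
    rw [k1, k2, sub_self])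
  exact sub_eq_zero.1 (hz s (mul_ne_zero hs hs'))

/-- Embedding of the variables of one side. -/
def rho {n : ℕ} (b : Bool) (o : Option (Fin n)) : Bool ⊕ (Fin n ⊕ Fin n) :=
  o.elim (Sum.inl b) fun k => Sum.inr (sd b k)

/-- Renaming to the final variables. -/
def rr {n : ℕ} : Bool ⊕ (Fin n ⊕ Fin n) → Option (Fin n) ⊕ Option (Fin n)
  | Sum.inl true => Sum.inl none
  | Sum.inl false => Sum.inr none
  | Sum.inr (Sum.inl k) => Sum.inl (some k)
  | Sum.inr (Sum.inr k) => Sum.inr (some k)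

lemma eval_rho {n : ℕ} (θ : (Fin n → ℂ) → ℂ) (φ : Fin n → (Fin n → ℂ) → ℂ) (b : Bool)
    (w : Fin n ⊕ Fin n → ℂ) (p : MvPolynomial (Option (Fin n)) ℂ) :
    MvPolynomial.eval (Sum.elim (fun b => θ (Lc b w)) (Psi φ (Lc true) (Lc false) w))
      (MvPolynomial.rename (rho b) p) = MvPolynomial.eval (tval θ φ (Lc b w)) p := by
  rw [MvPolynomial.eval_rename]
  congr 2
  ext o
  cases o with
  | none => rfl
  | some k => exact Psi_sd φ b k w

lemma eval_rr {n : ℕ} (θ : (Fin n → ℂ) → ℂ) (φ : Fin n → (Fin n → ℂ) → ℂ)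
    (u v : Fin n → ℂ) (p : MvPolynomial (Bool ⊕ (Fin n ⊕ Fin n)) ℂ) :
    MvPolynomial.eval (Sum.elim (tval θ φ u) (tval θ φ v)) (MvPolynomial.rename rr p) =
    MvPolynomial.eval (Sum.elim (fun b => θ (Lc b (Sum.elim u v)))
      (Psi φ (Lc true) (Lc false) (Sum.elim u v))) p := by
  rw [MvPolynomial.eval_rename]
  congr 2
  ext i
  rcases i with (_ | _) | (k | k) <;> rfl

lemma period_one {n : ℕ} {h0 : (Fin n → ℂ) → ℂ} (hh : ∀ u, AnalyticAt ℂ h0 u)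
    (hne : ∃ u, h0 u ≠ 0) (ω1 ω2 : Fin n → ℂ) (u : Fin n → ℂ) :
    ∃ v, h0 v ≠ 0 ∧ h0 (v + ω2) ≠ 0 ∧ h0 (u - v) ≠ 0 ∧ h0 (u + ω1 - (v + ω2)) ≠ 0 := by
  obtain ⟨v, hv⟩ := entire_mul_ne (fun v => (hh v).mul (an_shift hh ω2 v))
    (fun v => (an_refl hh u v).mul (an_refl hh (u + ω1 - ω2) v))
    (entire_mul_ne hh (an_shift hh ω2) hne (entire_shift_ne hne _))
    (entire_mul_ne (an_refl hh u) (an_refl hh _) (entire_refl_ne hne _) (entire_refl_ne hne _))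
  have e : u + ω1 - (v + ω2) = u + ω1 - ω2 - v := by abel
  simp only [Pi.mul_apply, mul_ne_zero_iff] at hv
  exact ⟨v, hv.1.1, hv.1.2, hv.2.1, by rw [e]; exact hv.2.2⟩

lemma period_two {n : ℕ} {h0 : (Fin n → ℂ) → ℂ} (hh : ∀ u, AnalyticAt ℂ h0 u)
    (hne : ∃ u, h0 u ≠ 0) (ω1 ω2 : Fin n → ℂ) (v : Fin n → ℂ) :
    ∃ u, h0 u ≠ 0 ∧ h0 (u + ω1) ≠ 0 ∧ h0 (u - v) ≠ 0 ∧ h0 (u + ω1 - (v + ω2)) ≠ 0 := by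
  obtain ⟨u, hu⟩ := entire_mul_ne (fun u => (hh u).mul (an_shift hh ω1 u))
    (fun u => (an_shift hh (-v) u).mul (an_shift hh (ω1 - (v + ω2)) u))
    (entire_mul_ne hh (an_shift hh ω1) hne (entire_shift_ne hne _))
    (entire_mul_ne (an_shift hh _) (an_shift hh _) (entire_shift_ne hne _) (entire_shift_ne hne _))
  have e : u + ω1 - (v + ω2) = u + (ω1 - (v + ω2)) := by abel
  simp only [Pi.mul_apply, mul_ne_zero_iff] at hu
  exact ⟨u, hu.1.1, hu.1.2, by rw [sub_eq_add_neg]; exact hu.2.1, by rw [e]; exact hu.2.2⟩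

end PartQ8

open Filter Topology Metric

theorem aat_subtraction_theorem {n : ℕ} (hn : 1 ≤ n) (φ : Fin n → (Fin n → ℂ) → ℂ)
    (hmero : ∀ k, Mero (φ k)) (hindep : AnalyticallyIndep φ) (haat : AdmitsAAT φ)
    (θ : (Fin n → ℂ) → ℂ) (α : Fin n → Fin n → ℂ)
    (hθ : ∀ u, θ u = ∑ k : Fin n, ∑ p : Fin n, α k p * pd (φ k) p u)
    (V : MvPolynomial (Option (Fin n)) ℂ) (hV0 : V ≠ 0)
    (hV : ∀ u, (∀ j, AnalyticAt ℂ (φ j) u) → (∀ j p, AnalyticAt ℂ (pd (φ j) p) u) →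
      eval (tval θ φ u) V = 0)
    (A B : Fin n → Fin n → MvPolynomial (Option (Fin n)) ℂ)
    (hBne : ∀ k p, ∃ u, (∀ j, AnalyticAt ℂ (φ j) u) ∧ (∀ j q, AnalyticAt ℂ (pd (φ j) q) u) ∧
      eval (tval θ φ u) (B k p) ≠ 0)
    (hAB : ∀ k p u, (∀ j, AnalyticAt ℂ (φ j) u) → (∀ j q, AnalyticAt ℂ (pd (φ j) q) u) →
      eval (tval θ φ u) (B k p) ≠ 0 →
      pd (φ k) p u = eval (tval θ φ u) (A k p) / eval (tval θ φ u) (B k p)) :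
    ∃ N D : Fin n → MvPolynomial (Option (Fin n) ⊕ Option (Fin n)) ℂ,
      ∃ S : Set ((Fin n → ℂ) × (Fin n → ℂ)), IsOpen S ∧ S.Nonempty ∧
        ∀ w ∈ S, (∀ j, AnalyticAt ℂ (φ j) w.1) ∧ (∀ j, AnalyticAt ℂ (φ j) w.2) ∧
          (∀ j, AnalyticAt ℂ (φ j) (w.1 - w.2)) ∧
          AnalyticAt ℂ θ w.1 ∧ AnalyticAt ℂ θ w.2 ∧
          ∀ k : Fin n,
            eval (Sum.elim (tval θ φ w.1) (tval θ φ w.2)) (D k) ≠ 0 ∧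
            φ k (w.1 - w.2) =
              eval (Sum.elim (tval θ φ w.1) (tval θ φ w.2)) (N k) /
                eval (Sum.elim (tval θ φ w.1) (tval θ φ w.2)) (D k) := by
  classical
  choose g h hg hh hhne hgh using hmero
  -- the common denominator
  obtain ⟨h0, hh0, hh0ne, hφ⟩ : ∃ h0 : (Fin n → ℂ) → ℂ, (∀ u, AnalyticAt ℂ h0 u) ∧ (∃ u, h0 u ≠ 0) ∧
      ∀ k, MF h0 (φ k) := by
    refine ⟨fun u => ∏ k, h k u, fun u => Finset.analyticAt_fun_prod _ fun k _ => hh k u,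
      entire_prod_ne hh hhne _, fun k => ?_⟩
    refine MF.of_mul (H := h k) (K := fun u => ∏ j ∈ Finset.univ.erase k, h j u) ?_
      (fun u => Finset.analyticAt_fun_prod _ fun k _ => hh k u)
      (fun u => (Finset.mul_prod_erase _ (fun j => h j u) (Finset.mem_univ k)).symm)
    refine ⟨1, g k, hg k, fun u hu => ?_⟩
    rw [hgh k u hu, pow_one, div_mul_cancel₀ _ hu]
  have hφan : ∀ u, h0 u ≠ 0 → ∀ j, AnalyticAt ℂ (φ j) u := fun u hu j => (hφ j).analyticAt hh0 hu
  have hpdan : ∀ u, h0 u ≠ 0 → ∀ j p, AnalyticAt ℂ (pd (φ j) p) u := fun u hu j p =>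
    pd_analyticAt (hφan u hu j) p
  have hpdMF : ∀ k p, MF h0 (pd (φ k) p) := fun k p => (hφ k).dir hh0 _
  have hθMF : MF h0 θ := by
    refine MF.congr (MF.sum hh0 Finset.univ (fun k _ => MF.sum hh0 Finset.univ
      (fun p _ => (MF.const (α k p)).mul (hpdMF k p)))) fun u _ => hθ u
  have hθan : ∀ u, (∀ j, AnalyticAt ℂ (φ j) u) → AnalyticAt ℂ θ u := by
    intro u hu
    have : θ = fun u => ∑ k : Fin n, ∑ p : Fin n, α k p * pd (φ k) p u := funext hθ
    rw [this]
    exact Finset.analyticAt_fun_sum _ fun k _ => Finset.analyticAt_fun_sum _ fun p _ =>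
      analyticAt_const.mul (pd_analyticAt (hu k) p)
  -- the denominators in `(u, v)`
  let Ls : (Fin n ⊕ Fin n → ℂ) →L[ℂ] (Fin n → ℂ) := Lc true - Lc false
  have hLs : ∀ w, Ls w = Lc true w - Lc false w := fun w => rfl
  let H : (Fin n ⊕ Fin n → ℂ) → ℂ := fun w => h0 (Lc true w) * h0 (Lc false w) * h0 (Ls w)
  have hcomp : ∀ (L : (Fin n ⊕ Fin n → ℂ) →L[ℂ] (Fin n → ℂ)) w, AnalyticAt ℂ (fun w => h0 (L w)) w :=
    fun L w => AnalyticAt.fun_comp (hh0 _) (L.analyticAt w)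
  have hH : ∀ w, AnalyticAt ℂ H w := fun w => ((hcomp _ w).mul (hcomp _ w)).mul (hcomp _ w)
  have hHb : ∀ b w, H w ≠ 0 → h0 (Lc b w) ≠ 0 := by
    intro b w hw
    cases b
    · exact right_ne_zero_of_mul (left_ne_zero_of_mul hw)
    · exact left_ne_zero_of_mul (left_ne_zero_of_mul hw)
  have hHs : ∀ w, H w ≠ 0 → h0 (Ls w) ≠ 0 := fun w hw => right_ne_zero_of_mul hw
  have hHne : ∃ w, H w ≠ 0 := by
    obtain ⟨u, hu⟩ := hh0ne
    refine entire_mul_ne (fun w => (hcomp _ w).mul (hcomp _ w)) (hcomp Ls)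
      (entire_mul_ne (hcomp _) (hcomp _) ⟨Sum.elim u 0, ?_⟩ ⟨Sum.elim 0 u, ?_⟩)
      ⟨Sum.elim u 0, ?_⟩
    · rwa [Lc_elim_true]
    · rwa [Lc_elim_false]
    · rwa [hLs, Lc_elim_true, Lc_elim_false, sub_zero]
  have hMFb : ∀ b {f : (Fin n → ℂ) → ℂ}, MF h0 f → MF H (fun w => f (Lc b w)) := by
    intro b f hf
    have h1 : MF (fun w => h0 (Lc b w)) (fun w => f (Lc b w)) :=
      MF.comp (L := Lc b) (fun w => (Lc b).analyticAt w) hf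
    cases b
    · exact h1.of_mul (K := fun w => h0 (Lc true w) * h0 (Ls w))
        (fun w => (hcomp _ w).mul (hcomp _ w)) fun w => by simp only [H]; ring
    · exact h1.of_mul (K := fun w => h0 (Lc false w) * h0 (Ls w))
        (fun w => (hcomp _ w).mul (hcomp _ w)) fun w => by simp only [H]; ring
  have hMFs : ∀ {f : (Fin n → ℂ) → ℂ}, MF h0 f → MF H (fun w => f (Ls w)) := by
    intro f hf
    have h1 : MF (fun w => h0 (Ls w)) (fun w => f (Ls w)) :=
      MF.comp (L := Ls) (fun w => Ls.analyticAt w) hf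
    exact h1.of_mul (K := fun w => h0 (Lc true w) * h0 (Lc false w))
        (fun w => (hcomp _ w).mul (hcomp _ w)) fun w => by simp only [H]; ring
  let Ψ : (Fin n ⊕ Fin n → ℂ) → (Fin n ⊕ Fin n → ℂ) := Psi φ (Lc true) (Lc false)
  let Ψ' : (Fin n ⊕ Fin n → ℂ) → (Fin n ⊕ Fin n → ℂ) := Psi φ Ls (Lc false)
  have hΨ : ∀ i, MF H (fun w => Ψ w i) := by
    rintro (k | k)
    · exact hMFb true (hφ k)
    · exact hMFb false (hφ k)
  have hΨ' : ∀ i, MF H (fun w => Ψ' w i) := by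
    rintro (k | k)
    · exact hMFs (hφ k)
    · exact hMFb false (hφ k)
  -- points where the Jacobians do not vanish
  obtain ⟨us, hus, hdet⟩ := hindep
  have hev := det_eventually hus hdet
  have hpt : ∀ (L1 L2 : (Fin n ⊕ Fin n → ℂ) →L[ℂ] (Fin n → ℂ)), (∀ w, L1 w = 0 → L2 w = 0 → w = 0) →
      (∃ w, L1 w = us ∧ L2 w = us) → ∃ w, H w ≠ 0 ∧ Function.Injective (fderiv ℂ (Psi φ L1 L2) w) := by
    rintro L1 L2 hL ⟨w, hw1, hw2⟩
    have t1 : Tendsto L1 (𝓝 w) (𝓝 us) := by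
      have := L1.continuous.tendsto w
      rwa [hw1] at this
    have t2 : Tendsto L2 (𝓝 w) (𝓝 us) := by
      have := L2.continuous.tendsto w
      rwa [hw2] at this
    obtain ⟨w1, hw1, h1, h2⟩ := exists_ne_of_eventually hH hHne
      ((t1.eventually hev).and (t2.eventually hev))
    exact ⟨w1, hw1, Psi_inj hL h1.1 h2.1 h1.2 h2.2⟩
  obtain ⟨w1, hw1, hinj⟩ := hpt (Lc true) (Lc false) (fun w => Lc_ext) ⟨Sum.elim us us, rfl, rfl⟩
  obtain ⟨w2, hw2, hinj'⟩ := hpt Ls (Lc false)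
    (fun w h1 h2 => Lc_ext (by rwa [hLs, h2, sub_zero] at h1) h2)
    ⟨Sum.elim (us + us) us, by rw [hLs, Lc_elim_true, Lc_elim_false, add_sub_cancel_right], rfl⟩
  -- algebraicity of the difference functions
  have hFa : ∀ k, ∃ Q : Polynomial (MvPolynomial (Fin n ⊕ Fin n) ℂ), Q ≠ 0 ∧
      ∀ w, H w ≠ 0 → ev Q (φ k (Ls w)) (Ψ w) = 0 := by
    intro k
    refine exchange hH hΨ hΨ' hw1 hinj hw2 hinj' ?_ (Sum.inl k)
    rintro (k | k)
    · obtain ⟨G, hG1, hG⟩ := haat k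
      have hG0 : G ≠ 0 := by
        rintro rfl
        simp at hG1
      refine ⟨_, option_map_ne_zero Function.injective_id hG0, fun w hw => ?_⟩
      rw [ev_option]
      have h1 := hG (Ls w) (Lc false w) (hφan _ (hHs w hw)) (hφan _ (hHb false w hw))
      have e : Ls w + Lc false w = Lc true w := by rw [hLs]; abel
      rw [e] at h1
      exact h1 (hφan _ (hHb true w hw) k)
    · refine ⟨Polynomial.X - Polynomial.C (MvPolynomial.X (Sum.inr k)),
        Polynomial.X_sub_C_ne_zero _, fun w hw => ?_⟩
      simp only [ev, Polynomial.map_sub, Polynomial.map_X, Polynomial.map_C, MvPolynomial.eval_X,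
        Polynomial.eval_sub, Polynomial.eval_X, Polynomial.eval_C]
      exact sub_self _
  have hxa : ∀ b : Bool, ∃ Q : Polynomial (MvPolynomial (Fin n ⊕ Fin n) ℂ), Q ≠ 0 ∧
      ∀ w, H w ≠ 0 → ev Q (θ (Lc b w)) (Ψ w) = 0 := by
    intro b
    refine ⟨_, option_map_ne_zero (sd_inj b) hV0, fun w hw => ?_⟩
    rw [ev_option]
    have h1 := hV (Lc b w) (hφan _ (hHb b w hw)) (hpdan _ (hHb b w hw))
    rw [← h1]
    congr 2
    ext o
    cases o with
    | none => rfl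
    | some k => exact Psi_sd φ b k w
  have hBcont : ∀ k p u, (∀ j, AnalyticAt ℂ (φ j) u) →
      ContinuousAt (fun u => MvPolynomial.eval (tval θ φ u) (B k p)) u := by
    intro k p u hu
    have h1 : ContinuousAt (fun u => tval θ φ u) u := by
      rw [continuousAt_pi]
      rintro (_ | j)
      · exact (hθan u hu).continuousAt
      · exact (hu j).continuousAt
    exact ContinuousAt.comp (f := fun u => tval θ φ u)
      (g := fun z => MvPolynomial.eval z (B k p))
      (MvPolynomial.continuous_eval _).continuousAt h1
  have htMF : ∀ o : Option (Fin n), MF h0 (fun u => tval θ φ u o) := by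
    rintro (_ | j)
    · exact hθMF
    · exact hφ j
  have hABall : ∀ k p u, h0 u ≠ 0 → MvPolynomial.eval (tval θ φ u) (B k p) * pd (φ k) p u =
      MvPolynomial.eval (tval θ φ u) (A k p) := by
    intro k p
    obtain ⟨uB, huB, -, hB⟩ := hBne k p
    obtain ⟨u1, hu1, hB1⟩ := exists_ne_of_eventually hh0 hh0ne
      ((hBcont k p uB huB).eventually_ne hB)
    have hz := MF.identity hh0 (((MF.mvpoly hh0 htMF (B k p)).mul (hpdMF k p)).sub hh0
      (MF.mvpoly hh0 htMF (A k p))) hu1 (by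
        filter_upwards [eventually_ne_of_analytic hh0 hu1,
          (hBcont k p u1 (hφan u1 hu1)).eventually_ne hB1] with x hx hx'
        have h1 := hAB k p x (hφan x hx) (hpdan x hx) hx'
        rw [eq_div_iff hx'] at h1
        rw [sub_eq_zero, mul_comm]
        exact h1)
    exact fun u hu => sub_eq_zero.1 (hz u hu)
  have hJ : ∀ i j, ∃ N D : MvPolynomial (Bool ⊕ (Fin n ⊕ Fin n)) ℂ,
      (∃ w, H w ≠ 0 ∧ MvPolynomial.eval (Sum.elim (fun b => θ (Lc b w)) (Ψ w)) D ≠ 0) ∧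
      ∀ w, H w ≠ 0 → MvPolynomial.eval (Sum.elim (fun b => θ (Lc b w)) (Ψ w)) D *
        fderiv ℂ (fun w => Ψ w i) w (Pi.single j 1) =
        MvPolynomial.eval (Sum.elim (fun b => θ (Lc b w)) (Ψ w)) N := by
    intro i j
    obtain ⟨b, k, rfl⟩ := sd_cases i
    obtain ⟨b', p, rfl⟩ := sd_cases j
    have hfd : ∀ w, H w ≠ 0 → fderiv ℂ (fun w => Ψ w (sd b k)) w (Pi.single (sd b' p) 1) =
        if b = b' then pd (φ k) p (Lc b w) else 0 := by
      intro w hw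
      have e : (fun w => Ψ w (sd b k)) = fun w => φ k (Lc b w) := funext fun w => Psi_sd φ b k w
      rw [e, fderiv_comp_clm _ (hφan _ (hHb b w hw) k), Lc_single]
      split_ifs
      · rfl
      · exact map_zero _
    by_cases hb : b = b'
    · refine ⟨MvPolynomial.rename (rho b) (A k p), MvPolynomial.rename (rho b) (B k p), ?_, ?_⟩
      · obtain ⟨uB, huB, -, hB⟩ := hBne k p
        have hcont := hBcont k p uB huB
        obtain ⟨ws, hws⟩ : ∃ ws : Fin n ⊕ Fin n → ℂ, Lc b ws = uB := by
          exact ⟨Sum.elim uB uB, by cases b <;> rfl⟩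
        have t : Tendsto (Lc b) (𝓝 ws) (𝓝 uB) := by
          have := (Lc b).continuous.tendsto ws
          rwa [hws] at this
        obtain ⟨w, hw, hw'⟩ := exists_ne_of_eventually hH hHne (t.eventually (hcont.eventually_ne hB))
        exact ⟨w, hw, by rw [eval_rho]; exact hw'⟩
      · intro w hw
        rw [hfd w hw, if_pos hb, eval_rho, eval_rho]
        exact hABall k p _ (hHb b w hw)
    · refine ⟨0, 1, ⟨w1, hw1, by simp⟩, fun w hw => ?_⟩
      rw [hfd w hw, if_neg hb]
      simp
  obtain ⟨𝒟, T, Γ, hDH, hDΨ, hDτ, hΓ, hlcΓ, hgood⟩ := AD.build hH hΨ hw1 hinj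
    (x := fun b w => θ (Lc b w)) (fun b => hMFb b hθMF) hxa hJ
    (F := fun k w => φ k (Ls w)) (fun k => hMFs (hφ k)) hFa
  obtain ⟨w0, hw0, hAT⟩ := 𝒟.AT (fun k w => φ k (Ls w)) (fun k => by rw [hDH]; exact hMFs (hφ k)) Γ
    (by rw [hDH, hDΨ]; exact hΓ) hlcΓ
    (by
      rw [hDH, hDΨ]
      intro ω hω k a ha ha'
      have hHelim : ∀ u v, h0 u ≠ 0 → h0 v ≠ 0 → h0 (u - v) ≠ 0 → H (Sum.elim u v) ≠ 0 :=
        fun u v h1 h2 h3 => mul_ne_zero (mul_ne_zero h1 h2) h3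
      have hadd : ∀ u v : Fin n → ℂ, Sum.elim u v + ω = Sum.elim (u + Lc true ω) (v + Lc false ω) := by
        intro u v
        ext (j | j) <;> rfl
      have e1 : ∀ u, h0 u ≠ 0 → h0 (u + Lc true ω) ≠ 0 → φ k (u + Lc true ω) = φ k u := by
        intro u hu hu'
        obtain ⟨v, hv1, hv2, hv3, hv4⟩ := period_one hh0 hh0ne (Lc true ω) (Lc false ω) u
        have h1 := hω (Sum.elim u v) (hHelim _ _ hu hv1 hv3)
          (by rw [hadd]; exact hHelim _ _ hu' hv2 hv4)
        rw [hadd] at h1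
        exact congrFun h1 (Sum.inl k)
      have e2 : ∀ v, h0 v ≠ 0 → h0 (v + Lc false ω) ≠ 0 → φ k (v + Lc false ω) = φ k v := by
        intro v hv hv'
        obtain ⟨u, hu1, hu2, hu3, hu4⟩ := period_two hh0 hh0ne (Lc true ω) (Lc false ω) v
        have h1 := hω (Sum.elim u v) (hHelim _ _ hu1 hv hu3)
          (by rw [hadd]; exact hHelim _ _ hu2 hv' hu4)
        rw [hadd] at h1
        exact congrFun h1 (Sum.inr k)
      have e3 : Ls (a + ω) = Ls a + (Lc true ω - Lc false ω) := map_add _ _ _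
      have h4 := hHs _ ha'
      rw [e3] at h4 ⊢
      exact period_sub hh0 hh0ne (hφ k) e1 e2 _ (hHs _ ha) h4)
    hgood
  rw [hDΨ, hDτ] at hAT
  choose Num Den hND using hAT
  have hw0H : H w0 ≠ 0 := by
    have := hw0.1
    rwa [hDH] at this
  have hall : ∀ᶠ w in 𝓝 w0, H w ≠ 0 ∧ ∀ k, MvPolynomial.eval (Ψ w) (Den k) ≠ 0 ∧
      φ k (Ls w) * MvPolynomial.eval (Ψ w) (Den k) = ev (Num k)
        (MvPolynomial.eval (Sum.elim (fun b => θ (Lc b w)) (Ψ w)) T) (Ψ w) :=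
    (eventually_ne_of_analytic hH hw0H).and (eventually_all.2 hND)
  obtain ⟨U, hU, hUo, hwU⟩ := _root_.eventually_nhds_iff.1 hall
  refine ⟨fun k => MvPolynomial.rename rr ((Num k).eval₂
      (MvPolynomial.rename Sum.inr : MvPolynomial (Fin n ⊕ Fin n) ℂ →ₐ[ℂ]
        MvPolynomial (Bool ⊕ (Fin n ⊕ Fin n)) ℂ).toRingHom T),
    fun k => MvPolynomial.rename rr (MvPolynomial.rename Sum.inr (Den k)),
    (fun w : (Fin n → ℂ) × (Fin n → ℂ) => (Sum.elim w.1 w.2 : Fin n ⊕ Fin n → ℂ)) ⁻¹' U, ?_,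
    ⟨(Lc true w0, Lc false w0), ?_⟩, ?_⟩
  · refine hUo.preimage (continuous_pi ?_)
    rintro (j | j)
    · exact (continuous_apply j).comp continuous_fst
    · exact (continuous_apply j).comp continuous_snd
  · have : (Sum.elim (Lc true w0) (Lc false w0) : Fin n ⊕ Fin n → ℂ) = w0 := by
      ext (j | j) <;> rfl
    rw [Set.mem_preimage, this]
    exact hwU
  · rintro ⟨u, v⟩ huv
    obtain ⟨h1, h2⟩ := hU _ huv
    have hu := hφan u (hHb true _ h1)
    have hv := hφan v (hHb false _ h1)
    refine ⟨hu, hv, hφan (u - v) (hHs _ h1), hθan u hu, hθan v hv, fun k => ?_⟩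
    obtain ⟨h3, h4⟩ := h2 k
    have hD : MvPolynomial.eval (Sum.elim (tval θ φ u) (tval θ φ v))
        (MvPolynomial.rename rr (MvPolynomial.rename (Sum.inr : Fin n ⊕ Fin n → Bool ⊕ _) (Den k))) =
        MvPolynomial.eval (Ψ (Sum.elim u v)) (Den k) := by
      rw [eval_rr, MvPolynomial.eval_rename]
      rfl
    refine ⟨?_, ?_⟩
    · rw [hD]; exact h3
    · rw [hD, eq_div_iff h3, eval_rr, eval_eval₂_ev]
      exact h4
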